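/- arXiv:2201.08971 — 2 statements merged into one kernel-verified Lean document; each statement's English description precedes it below -/
import Mathlib

section
/- Let N ∈ {2,3} and let Ω be the open unit ball in ℝ^N. Let n ∈ C([0,1]) and σ ∈ C²([0,1]) satisfy Assumption A, regarded as radial coefficients σ(|x|), n(|x|) on the closed unit ball. Then for every τ ∈ (0,1) there exist a sequence of positive numbers k_m with k_m → ∞ as m → ∞ and, for each m, a transmission eigenpair (u_m, v_m) for (k_m, σ(|x|), n(|x|)) with v_m not identically zero, such that ‖v_m‖_{L²(Ω_τ)} / ‖v_m‖_{L²(Ω)} → 0 as m → ∞. -/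
open Metric MeasureTheory Filter Set

noncomputable section

/-- The divergence-form operator `∇·(σ(|x|)∇u)(x)` on `ℝ^N`,
written as `∑ i ∂_i (σ(|y|) ∂_i u)(x)`. -/
def divSigmaGrad (N : ℕ) (σ : ℝ → ℝ) (u : EuclideanSpace ℝ (Fin N) → ℂ)
    (x : EuclideanSpace ℝ (Fin N)) : ℂ :=
  ∑ i : Fin N,
    fderiv ℝ (fun y => (σ ‖y‖ : ℂ) * fderiv ℝ u y (EuclideanSpace.single i 1)) x
      (EuclideanSpace.single i 1)

/-- The Laplacian `Δv(x) = ∑ i ∂_i ∂_i v (x)` on `ℝ^N`. -/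
def lap (N : ℕ) (v : EuclideanSpace ℝ (Fin N) → ℂ) (x : EuclideanSpace ℝ (Fin N)) : ℂ :=
  ∑ i : Fin N,
    fderiv ℝ (fun y => fderiv ℝ v y (EuclideanSpace.single i 1)) x (EuclideanSpace.single i 1)

/-- A transmission eigenpair `(u, v)` for `(k, σ(|x|), n(|x|))` on the open unit ball
`Ω ⊂ ℝ^N`: `u, v ∈ C²(Ω) ∩ C¹(closure Ω)`, not both identically zero, satisfying
`∇·(σ∇u) + k²n²u = 0` and `Δv + k²v = 0` in `Ω`, together with `u = v` and
`σ ∂u/∂ν = ∂v/∂ν` on `∂Ω` (where `ν(x) = x`). -/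
def IsTransmissionEigenpair (N : ℕ) (k : ℝ) (σ n : ℝ → ℝ)
    (u v : EuclideanSpace ℝ (Fin N) → ℂ) : Prop :=
  ContDiffOn ℝ 2 u (ball (0 : EuclideanSpace ℝ (Fin N)) 1) ∧
  ContDiffOn ℝ 1 u (closedBall (0 : EuclideanSpace ℝ (Fin N)) 1) ∧
  ContDiffOn ℝ 2 v (ball (0 : EuclideanSpace ℝ (Fin N)) 1) ∧
  ContDiffOn ℝ 1 v (closedBall (0 : EuclideanSpace ℝ (Fin N)) 1) ∧
  (∀ x ∈ ball (0 : EuclideanSpace ℝ (Fin N)) 1,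
    divSigmaGrad N σ u x + (k : ℂ) ^ 2 * (n ‖x‖ : ℂ) ^ 2 * u x = 0) ∧
  (∀ x ∈ ball (0 : EuclideanSpace ℝ (Fin N)) 1,
    lap N v x + (k : ℂ) ^ 2 * v x = 0) ∧
  (∀ x : EuclideanSpace ℝ (Fin N), ‖x‖ = 1 → u x = v x) ∧
  (∀ x : EuclideanSpace ℝ (Fin N), ‖x‖ = 1 →
    (σ 1 : ℂ) * fderivWithin ℝ u (closedBall (0 : EuclideanSpace ℝ (Fin N)) 1) x x
      = fderivWithin ℝ v (closedBall (0 : EuclideanSpace ℝ (Fin N)) 1) x x) ∧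
  ¬ (EqOn u 0 (closedBall (0 : EuclideanSpace ℝ (Fin N)) 1) ∧
     EqOn v 0 (closedBall (0 : EuclideanSpace ℝ (Fin N)) 1))

/-- The `L²` norm of `f` on the ball of radius `τ` centered at the origin. -/
def ballL2 (N : ℕ) (f : EuclideanSpace ℝ (Fin N) → ℂ) (τ : ℝ) : ℝ :=
  Real.sqrt (∫ x in ball (0 : EuclideanSpace ℝ (Fin N)) τ, ‖f x‖ ^ 2)

/-- Assumption A: `n ∈ C([0,1])`, `σ ∈ C²([0,1])`, with constants
`1 < n₁ < n₂`, `1 < M₁ < M₂`, such that on `[0,1]` one has `n₁ < n < n₂`, `σ' ≤ 0`,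
`M₁ ≤ n²/σ ≤ M₂` and `σ'² ≥ 2σ''σ`. -/
def AssumptionA (n σ : ℝ → ℝ) (n₁ n₂ M₁ M₂ : ℝ) : Prop :=
  1 < n₁ ∧ n₁ < n₂ ∧ 1 < M₁ ∧ M₁ < M₂ ∧
  ContinuousOn n (Icc 0 1) ∧ ContDiffOn ℝ 2 σ (Icc 0 1) ∧
  ∀ r ∈ Icc (0:ℝ) 1,
    n₁ < n r ∧ n r < n₂ ∧
    derivWithin σ (Icc 0 1) r ≤ 0 ∧
    M₁ ≤ n r ^ 2 / σ r ∧ n r ^ 2 / σ r ≤ M₂ ∧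
    2 * derivWithin (derivWithin σ (Icc 0 1)) (Icc 0 1) r * σ r
      ≤ (derivWithin σ (Icc 0 1) r) ^ 2


lemma volterra_aux_exp (L r : ℝ) (hL : 0 < L) :
    Real.exp (-L * r) * ∫ t in (0:ℝ)..r, Real.exp (L * t) ≤ 1 / L := by
  rw [intervalIntegral.integral_comp_mul_left (fun x => Real.exp x) hL.ne']
  simp only [integral_exp, mul_zero, Real.exp_zero, smul_eq_mul]
  have h : Real.exp (-L * r) * Real.exp (L * r) = 1 := by
    rw [← Real.exp_add]; simp
  have h2 := Real.exp_pos (-L * r)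
  have : Real.exp (-L * r) * (L⁻¹ * (Real.exp (L * r) - 1))
      = L⁻¹ * (1 - Real.exp (-L * r)) := by
    linear_combination L⁻¹ * h
  rw [this, one_div]
  have hLi : 0 < L⁻¹ := inv_pos.mpr hL
  nlinarith

/-- Volterra integral equation with parameter. -/
lemma volterra (ρ : ℝ → ℝ) (hρ : Continuous ρ) (c : ℝ × ℝ → ℝ) (hc : Continuous c) (p : ℕ)
    (K : ℝ) (hK : 0 ≤ K) :
    ∃ g : ℝ × ℝ → ℝ, Continuous g ∧ ∀ r ∈ Icc (0:ℝ) 1, ∀ k ∈ Icc (0:ℝ) K,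
      g (r, k) = 1 - ∫ t in (0:ℝ)..r, ρ t * ∫ ξ in (0:ℝ)..1, ξ ^ p * c (t * ξ, k) * g (t * ξ, k) := by
  classical
  -- bound
  obtain ⟨M, hM0, hM⟩ : ∃ M : ℝ, 0 ≤ M ∧ ∀ t ∈ Icc (0:ℝ) 1, ∀ s ∈ Icc (0:ℝ) 1, ∀ k ∈ Icc (0:ℝ) K,
      |ρ t| * |c (s, k)| ≤ M := by
    obtain ⟨M1, h1⟩ := (isCompact_Icc (a := (0:ℝ)) (b := 1)).exists_bound_of_continuousOn hρ.continuousOn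
    obtain ⟨M2, h2⟩ := ((isCompact_Icc (a := (0:ℝ)) (b := 1)).prod
      (isCompact_Icc (a := (0:ℝ)) (b := K))).exists_bound_of_continuousOn hc.continuousOn
    have hM1 : 0 ≤ M1 := (norm_nonneg _).trans (h1 0 (by simp))
    have hM2 : 0 ≤ M2 := (norm_nonneg _).trans (h2 (0, 0) (by simp [hK]))
    refine ⟨M1 * M2, by positivity, fun t ht s hs k hk => ?_⟩
    exact mul_le_mul (h1 t ht) (h2 (s, k) ⟨hs, hk⟩) (abs_nonneg _) hM1
  set L : ℝ := 2 * M + 1 with hLdef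
  have hL : 0 < L := by positivity
  let X := C(Icc (0:ℝ) 1 × Icc (0:ℝ) K, ℝ)
  let ex : X → ℝ × ℝ → ℝ := fun w z => w (projIcc 0 1 zero_le_one z.1, projIcc 0 K hK z.2)
  have hex : ∀ w, Continuous (ex w) := fun w => by
    apply w.continuous.comp
    exact ((continuous_projIcc.comp continuous_fst).prodMk (continuous_projIcc.comp continuous_snd))
  let I : X → ℝ × ℝ → ℝ := fun w z =>
    ∫ ξ in (0:ℝ)..1, ξ ^ p * c (z.1 * ξ, z.2) * (Real.exp (L * (z.1 * ξ)) * ex w (z.1 * ξ, z.2))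
  have hInt : ∀ w, Continuous (fun q : (ℝ × ℝ) × ℝ =>
      q.2 ^ p * c (q.1.1 * q.2, q.1.2) * (Real.exp (L * (q.1.1 * q.2)) * ex w (q.1.1 * q.2, q.1.2))) := by
    intro w
    have h1 : Continuous (fun q : (ℝ × ℝ) × ℝ => (q.1.1 * q.2, q.1.2)) := by fun_prop
    have := hc.comp h1
    have := (hex w).comp h1
    simp only [Function.comp_def] at *
    fun_prop
  have hI : ∀ w, Continuous (I w) := fun w =>
    intervalIntegral.continuous_parametric_intervalIntegral_of_continuous' (hInt w) 0 1
  let J : X → ℝ × ℝ → ℝ := fun w z => ∫ t in (0:ℝ)..z.1, ρ t * I w (t, z.2)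
  have hJint : ∀ w, Continuous (fun q : (ℝ × ℝ) × ℝ => ρ q.2 * I w (q.2, q.1.2)) := by
    intro w
    have h1 : Continuous (fun q : (ℝ × ℝ) × ℝ => (q.2, q.1.2)) := by fun_prop
    have := (hI w).comp h1
    simp only [Function.comp_def] at *
    fun_prop
  have hJ : ∀ w, Continuous (J w) := fun w =>
    intervalIntegral.continuous_parametric_intervalIntegral_of_continuous (hJint w) continuous_fst
  let T : X → X := fun w => ⟨fun x => Real.exp (-L * x.1) * (1 - J w (x.1, x.2)), by
    have h1 : Continuous (fun x : Icc (0:ℝ) 1 × Icc (0:ℝ) K => ((x.1 : ℝ), (x.2 : ℝ))) := by fun_prop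
    have := (hJ w).comp h1
    simp only [Function.comp_def] at *
    fun_prop⟩
  have hIdiff : ∀ w w' : X, ∀ t ∈ Icc (0:ℝ) 1, ∀ k ∈ Icc (0:ℝ) K,
      |ρ t * I w (t, k) - ρ t * I w' (t, k)| ≤ M * dist w w' * Real.exp (L * t) := by
    intro w w' t ht k hk
    have h1 : ∀ w : X, IntervalIntegrable (fun ξ : ℝ => ξ ^ p * c (t * ξ, k) *
        (Real.exp (L * (t * ξ)) * ex w (t * ξ, k))) volume 0 1 := fun w =>
      ((hInt w).comp (continuous_const.prodMk continuous_id : Continuous (fun ξ : ℝ => (((t, k), ξ) : (ℝ × ℝ) × ℝ)))).intervalIntegrable _ _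
    have : ρ t * I w (t, k) - ρ t * I w' (t, k) = ∫ ξ in (0:ℝ)..1, ρ t * (ξ ^ p * c (t * ξ, k) *
        (Real.exp (L * (t * ξ)) * (ex w (t * ξ, k) - ex w' (t * ξ, k)))) := by
      rw [intervalIntegral.integral_const_mul, ← mul_sub]
      simp only [I]
      rw [← intervalIntegral.integral_sub (h1 w) (h1 w')]
      congr 2; ext ξ; ring
    rw [this]
    have hb := intervalIntegral.norm_integral_le_of_norm_le_const (a := (0:ℝ)) (b := 1)
      (f := fun ξ => ρ t * (ξ ^ p * c (t * ξ, k) *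
        (Real.exp (L * (t * ξ)) * (ex w (t * ξ, k) - ex w' (t * ξ, k)))))
      (C := M * dist w w' * Real.exp (L * t)) ?_
    · simpa using hb
    · intro ξ hξ
      rw [uIoc_of_le zero_le_one] at hξ
      have hξ0 := hξ.1.le
      have hs : t * ξ ∈ Icc (0:ℝ) 1 := ⟨mul_nonneg ht.1 hξ0, mul_le_one₀ ht.2 hξ0 hξ.2⟩
      have hd : |ex w (t * ξ, k) - ex w' (t * ξ, k)| ≤ dist w w' := by
        rw [← Real.dist_eq]; exact ContinuousMap.dist_apply_le_dist _
      have he : Real.exp (L * (t * ξ)) ≤ Real.exp (L * t) := by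
        apply Real.exp_le_exp.mpr
        have := mul_le_of_le_one_right ht.1 hξ.2
        gcongr
      have hp : |ξ ^ p| ≤ 1 := by
        rw [abs_of_nonneg (by positivity)]; exact pow_le_one₀ hξ0 hξ.2
      rw [Real.norm_eq_abs]
      simp only [abs_mul, Real.abs_exp]
      calc |ρ t| * (|ξ ^ p| * |c (t * ξ, k)| * (Real.exp (L * (t * ξ)) * |ex w (t * ξ, k) - ex w' (t * ξ, k)|))
          = |ξ ^ p| * (|ρ t| * |c (t * ξ, k)|) * (|ex w (t * ξ, k) - ex w' (t * ξ, k)| * Real.exp (L * (t * ξ))) := by ring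
        _ ≤ 1 * M * (dist w w' * Real.exp (L * t)) := by
          have := hM t ht _ hs k hk
          gcongr
        _ = _ := by ring
  have hT : ContractingWith (1/2) T := by
    refine ⟨by norm_num, LipschitzWith.of_dist_le_mul fun w w' => ?_⟩
    rw [ContinuousMap.dist_le (by positivity)]
    rintro ⟨⟨r, hr⟩, ⟨k, hk⟩⟩
    rw [Real.dist_eq]
    simp only [T, ContinuousMap.coe_mk]
    have e1 : Real.exp (-L * r) * (1 - J w (r, k)) - Real.exp (-L * r) * (1 - J w' (r, k))
      = - (Real.exp (-L * r) * (J w (r, k) - J w' (r, k))) := by ring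
    rw [e1, abs_neg, abs_mul, Real.abs_exp]
    have h2 : ∀ w : X, IntervalIntegrable (fun t => ρ t * I w (t, k)) volume 0 r := fun w =>
      ((hJint w).comp (continuous_const.prodMk continuous_id : Continuous (fun ξ : ℝ => (((0, k), ξ) : (ℝ × ℝ) × ℝ)))).intervalIntegrable _ _
    have e2 : |J w (r, k) - J w' (r, k)| ≤ ∫ t in (0:ℝ)..r, M * dist w w' * Real.exp (L * t) := by
      simp only [J]
      rw [← intervalIntegral.integral_sub (h2 w) (h2 w')]
      rw [← Real.norm_eq_abs]
      apply intervalIntegral.norm_integral_le_of_norm_le hr.1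
      · refine Filter.Eventually.of_forall fun t ht => ?_
        exact hIdiff w w' t ⟨ht.1.le, ht.2.trans hr.2⟩ k hk
      · exact (by fun_prop : Continuous fun t => M * dist w w' * Real.exp (L * t)).intervalIntegrable _ _
    rw [intervalIntegral.integral_const_mul] at e2
    have e3 := volterra_aux_exp L r hL
    have e4 : M * (1 / L) ≤ 1 / 2 := by
      rw [mul_one_div, div_le_iff₀ hL]; linarith
    have hdn : 0 ≤ dist w w' := dist_nonneg
    calc Real.exp (-L * r) * |J w (r, k) - J w' (r, k)|
        ≤ Real.exp (-L * r) * (M * dist w w' * ∫ t in (0:ℝ)..r, Real.exp (L * t)) := by gcongr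
      _ = M * dist w w' * (Real.exp (-L * r) * ∫ t in (0:ℝ)..r, Real.exp (L * t)) := by ring
      _ ≤ M * dist w w' * (1 / L) := by gcongr
      _ = M * (1 / L) * dist w w' := by ring
      _ ≤ 1 / 2 * dist w w' := by gcongr
      _ = _ := by norm_num
  have : Nonempty X := ⟨0⟩
  let w : X := hT.fixedPoint
  have hw : T w = w := hT.fixedPoint_isFixedPt
  refine ⟨fun z => Real.exp (L * z.1) * ex w z, ?_, ?_⟩
  · have := hex w; fun_prop
  · intro r hr k hk
    have h3 : ex w (r, k) = w (⟨r, hr⟩, ⟨k, hk⟩) := by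
      simp only [ex]; rw [projIcc_of_mem _ hr, projIcc_of_mem _ hk]
    have h4 : w (⟨r, hr⟩, ⟨k, hk⟩) = Real.exp (-L * r) * (1 - J w (r, k)) := by
      conv_lhs => rw [← hw]
      rfl
    have h5 : Real.exp (L * r) * Real.exp (-L * r) = 1 := by rw [← Real.exp_add]; simp
    show Real.exp (L * r) * ex w (r, k) = _
    rw [h3, h4, ← mul_assoc, h5, one_mul]


structure RadCoef (σ dσ n : ℝ → ℝ) : Prop where
  cσ : Continuous σ
  cdσ : Continuous dσ
  cn : Continuous n
  pos : ∀ r, 0 < σ r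
  der : ∀ r ∈ Ioo (0:ℝ) 1, HasDerivAt σ (dσ r) r

structure RadSol (σ dσ n : ℝ → ℝ) (m p : ℕ) (K : ℝ) (g G : ℝ × ℝ → ℝ) : Prop where
  cg : Continuous g
  cG : Continuous G
  dg : ∀ r k, HasDerivAt (fun s => g (s, k)) (G (r, k)) r
  g0 : ∀ k, g (0, k) = 1
  dG : ∀ k ∈ Icc (0:ℝ) K, ∀ r ∈ Ioo (0:ℝ) 1,
    HasDerivAt (fun s => s ^ (p + 1) * (σ s * G (s, k)))
      (-(r ^ p * (m * dσ r + k ^ 2 * r * n r ^ 2) * g (r, k))) r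

lemma radSol_exists {σ dσ n : ℝ → ℝ} (h : RadCoef σ dσ n) (m p : ℕ) (K : ℝ) (hK : 0 ≤ K) :
    ∃ g G, RadSol σ dσ n m p K g G := by
  let c : ℝ × ℝ → ℝ := fun z => m * dσ z.1 + z.2 ^ 2 * z.1 * n z.1 ^ 2
  have hc : Continuous c := by
    have := h.cdσ; have := h.cn
    fun_prop
  have hρ : Continuous (fun t => (σ t)⁻¹) := h.cσ.inv₀ fun r => (h.pos r).ne'
  obtain ⟨g₀, hg₀, heq⟩ := volterra _ hρ c hc p K hK
  let I : ℝ × ℝ → ℝ := fun z => ∫ ξ in (0:ℝ)..1, ξ ^ p * c (z.1 * ξ, z.2) * g₀ (z.1 * ξ, z.2)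
  have hI : Continuous I := by
    apply intervalIntegral.continuous_parametric_intervalIntegral_of_continuous'
    have h1 : Continuous (fun q : (ℝ × ℝ) × ℝ => (q.1.1 * q.2, q.1.2)) := by fun_prop
    have := hc.comp h1
    have := hg₀.comp h1
    simp only [Function.comp_def] at *
    fun_prop
  let G : ℝ × ℝ → ℝ := fun z => -((σ z.1)⁻¹ * I z)
  have hG : Continuous G := ((hρ.comp continuous_fst).mul hI).neg
  let g : ℝ × ℝ → ℝ := fun z => 1 + ∫ t in (0:ℝ)..z.1, G (t, z.2)
  have hg : Continuous g := by
    have h1 : Continuous (fun q : (ℝ × ℝ) × ℝ => G (q.2, q.1.2)) :=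
      hG.comp (by fun_prop : Continuous fun q : (ℝ × ℝ) × ℝ => (q.2, q.1.2))
    have h2 : Continuous (fun z : ℝ × ℝ => ∫ t in (0:ℝ)..z.1, G (t, z.2)) :=
      intervalIntegral.continuous_parametric_intervalIntegral_of_continuous
        (f := fun (z : ℝ × ℝ) (t : ℝ) => G (t, z.2)) h1 continuous_fst
    exact continuous_const.add h2
  have hgg : ∀ r ∈ Icc (0:ℝ) 1, ∀ k ∈ Icc (0:ℝ) K, g₀ (r, k) = g (r, k) := by
    intro r hr k hk
    rw [heq r hr k hk]
    simp only [g, G, I, intervalIntegral.integral_neg]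
    ring
  refine ⟨g, G, hg, hG, ?_, ?_, ?_⟩
  · intro r k
    have hk : Continuous fun t => G (t, k) := hG.comp (by fun_prop : Continuous fun t : ℝ => (t, k))
    have := intervalIntegral.integral_hasDerivAt_right (hk.intervalIntegrable 0 r)
      hk.stronglyMeasurable.stronglyMeasurableAtFilter hk.continuousAt
    exact this.const_add 1
  · intro k; simp [g]
  · intro k hk r hr
    have hcont : Continuous fun s => s ^ p * c (s, k) * g₀ (s, k) := by
      have h1 : Continuous (fun s : ℝ => (s, k)) := by fun_prop
      have := hc.comp h1
      have := hg₀.comp h1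
      simp only [Function.comp_def] at *
      fun_prop
    have hd := (intervalIntegral.integral_hasDerivAt_right (hcont.intervalIntegrable 0 r)
      hcont.stronglyMeasurable.stronglyMeasurableAtFilter hcont.continuousAt).neg
    have hval : -(r ^ p * (m * dσ r + k ^ 2 * r * n r ^ 2) * g (r, k))
        = -(r ^ p * c (r, k) * g₀ (r, k)) := by
      rw [hgg r ⟨hr.1.le, hr.2.le⟩ k hk]
    rw [hval]
    refine hd.congr_of_eventuallyEq ?_
    filter_upwards [isOpen_Ioi.mem_nhds hr.1] with s hs
    have hs0 : s ≠ 0 := (ne_of_gt hs)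
    have hσ := (h.pos s).ne'
    have : I (s, k) = s⁻¹ * ((s ^ p)⁻¹ * ∫ t in (0:ℝ)..s, t ^ p * c (t, k) * g₀ (t, k)) := by
      simp only [I]
      have := intervalIntegral.integral_comp_mul_left (a := 0) (b := 1) (fun t => t ^ p * c (t, k) * g₀ (t, k)) hs0
      simp only [mul_zero, mul_one, smul_eq_mul] at this
      rw [mul_left_comm, ← this, ← intervalIntegral.integral_const_mul]
      congr 1; ext ξ
      rw [mul_pow]
      field_simp
    simp only [G, Pi.neg_apply]
    rw [this]
    field_simp
    ring


lemma RadSol.W_deriv {σ dσ n : ℝ → ℝ} (h : RadCoef σ dσ n) {m p : ℕ} {K : ℝ} {g G : ℝ × ℝ → ℝ}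
    (hs : RadSol σ dσ n m p K g G) {k : ℝ} (hk : k ∈ Icc (0:ℝ) K) {r : ℝ} (hr : r ∈ Ioo (0:ℝ) 1)
    (δ : ℝ) :
    HasDerivAt (fun s => s ^ ((p:ℝ) - δ) * (σ s * (s * G (s, k) + δ * g (s, k))))
      (r ^ ((p:ℝ) - δ - 1) * g (r, k) *
        (δ * (p - δ) * σ r - (m - δ) * r * dσ r - k ^ 2 * r ^ 2 * n r ^ 2)) r := by
  have hr0 : r ≠ 0 := hr.1.ne'
  have e1 : ∀ s : ℝ, 0 < s → s ^ ((p:ℝ) - δ) = s ^ p * s ^ (-δ) := fun s hs => by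
    rw [sub_eq_add_neg, Real.rpow_add hs, Real.rpow_natCast]
  have e2 : r ^ ((p:ℝ) - δ - 1) = r ^ p * r ^ (-δ) / r := by
    rw [Real.rpow_sub_one hr0, e1 r hr.1]
  have e3 : r ^ (-δ - 1) = r ^ (-δ) / r := Real.rpow_sub_one hr0 _
  have d1 := Real.hasDerivAt_rpow_const (x := r) (p := -δ) (Or.inl hr0)
  have d2 := hs.dG k hk r hr
  have d3 := (hasDerivAt_pow p r).mul ((h.der r hr).mul (hs.dg r k))
  have d := d1.mul (d2.add (d3.const_mul δ))
  refine (d.congr_of_eventuallyEq ?_).congr_deriv ?_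
  · filter_upwards [isOpen_Ioi.mem_nhds hr.1] with s hs
    simp only [Pi.mul_apply, Pi.add_apply]
    rw [e1 s hs]; ring
  · rw [e2, e3]
    simp only [Pi.mul_apply, Pi.add_apply]
    have e4 : (p:ℝ) * r ^ (p - 1) = p * (r ^ p / r) := by
      rcases Nat.eq_zero_or_pos p with h0 | h0
      · simp [h0]
      · obtain ⟨q, rfl⟩ := Nat.exists_eq_add_of_lt h0
        simp only [zero_add, Nat.add_sub_cancel, pow_succ]
        field_simp
    rw [e4]
    field_simp
    ring

lemma RadSol.pos {σ dσ n : ℝ → ℝ} (h : RadCoef σ dσ n) {m p : ℕ} {K : ℝ} {g G : ℝ × ℝ → ℝ}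
    (hs : RadSol σ dσ n m p K g G) {k : ℝ} (hk : k ∈ Icc (0:ℝ) K)
    (hdσ : ∀ r ∈ Ioo (0:ℝ) 1, dσ r ≤ 0) {δ R : ℝ} (hδ : 0 < δ) (hδm : δ ≤ m) (hδp : δ ≤ p)
    (hR : R ≤ 1)
    (hcond : ∀ r ∈ Ioo (0:ℝ) R, k ^ 2 * r ^ 2 * n r ^ 2 ≤ δ * (p - δ) * σ r) :
    (∀ r ∈ Icc (0:ℝ) R, 0 < g (r, k)) ∧ (∀ r ∈ Icc (0:ℝ) R, 0 ≤ r * G (r, k) + δ * g (r, k)) ∧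
      MonotoneOn (fun r => r ^ δ * g (r, k)) (Icc 0 R) := by
  have cgk : Continuous fun s => g (s, k) := hs.cg.comp (by fun_prop : Continuous fun t : ℝ => (t, k))
  have cGk : Continuous fun s => G (s, k) := hs.cG.comp (by fun_prop : Continuous fun t : ℝ => (t, k))
  have cσ := h.cσ
  have stepA : ∀ b, b ≤ R → (∀ r ∈ Ioo 0 b, 0 ≤ g (r, k)) →
      ∀ r ∈ Icc (0:ℝ) b, 0 ≤ r * G (r, k) + δ * g (r, k) := by
    intro b hb hg r hr
    rcases hr.1.eq_or_lt with h0 | h0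
    · rw [← h0, hs.g0]; simp [hδ.le]
    have hmono : MonotoneOn (fun s => s ^ ((p:ℝ) - δ) * (σ s * (s * G (s, k) + δ * g (s, k)))) (Icc 0 b) := by
      apply monotoneOn_of_hasDerivWithinAt_nonneg (convex_Icc 0 b)
        (f' := fun r => r ^ ((p:ℝ) - δ - 1) * g (r, k) *
        (δ * (p - δ) * σ r - (m - δ) * r * dσ r - k ^ 2 * r ^ 2 * n r ^ 2))
      · have : Continuous fun s : ℝ => s ^ ((p:ℝ) - δ) := Real.continuous_rpow_const (by linarith)
        exact (this.mul (cσ.mul ((continuous_id.mul cGk).add (continuous_const.mul cgk)))).continuousOn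
      · intro x hx
        rw [interior_Icc] at hx
        exact (hs.W_deriv h hk ⟨hx.1, by linarith [hx.2]⟩ δ).hasDerivWithinAt
      · intro x hx
        rw [interior_Icc] at hx
        have h1 := hcond x ⟨hx.1, by linarith [hx.2]⟩
        have h2 := hdσ x ⟨hx.1, by linarith [hx.2]⟩
        have h3 : 0 ≤ (m - δ) * x * (- dσ x) :=
          mul_nonneg (mul_nonneg (by linarith) hx.1.le) (by linarith)
        apply mul_nonneg (mul_nonneg (Real.rpow_nonneg hx.1.le _) (hg x hx))
        linarith
    have h1 := hmono ⟨le_rfl, h0.le.trans hr.2⟩ hr h0.le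
    have h2 : 0 ≤ r ^ ((p:ℝ) - δ) * (σ r * (r * G (r, k) + δ * g (r, k))) := by
      refine le_trans ?_ h1
      simp only [hs.g0, zero_mul, zero_add, mul_one]
      exact mul_nonneg (Real.rpow_nonneg le_rfl _) (mul_nonneg (h.pos 0).le hδ.le)
    exact nonneg_of_mul_nonneg_right (nonneg_of_mul_nonneg_right h2 (Real.rpow_pos_of_pos h0 _)) (h.pos r)
  have stepB : ∀ b, b ≤ R → (∀ r ∈ Ioo 0 b, 0 ≤ g (r, k)) →
      MonotoneOn (fun r => r ^ δ * g (r, k)) (Icc 0 b) := by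
    intro b hb hg
    apply monotoneOn_of_hasDerivWithinAt_nonneg (convex_Icc 0 b)
        (f' := fun r => r ^ (δ - 1) * (r * G (r, k) + δ * g (r, k)))
    · have : Continuous fun s : ℝ => s ^ δ := Real.continuous_rpow_const hδ.le
      exact (this.mul cgk).continuousOn
    · intro x hx
      rw [interior_Icc] at hx
      have d := (Real.hasDerivAt_rpow_const (x := x) (p := δ) (Or.inl hx.1.ne')).mul (hs.dg x k)
      refine (d.congr_deriv ?_).hasDerivWithinAt
      rw [Real.rpow_sub_one hx.1.ne']
      have := hx.1.ne'
      field_simp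
      ring
    · intro x hx
      rw [interior_Icc] at hx
      exact mul_nonneg (Real.rpow_nonneg hx.1.le _) (stepA b hb hg x ⟨hx.1.le, hx.2.le⟩)
  have stepC : ∀ r ∈ Icc (0:ℝ) R, 0 < g (r, k) := by
    by_contra hcon
    push Not at hcon
    obtain ⟨r₁, hr₁, hr₁'⟩ := hcon
    let S := Icc (0:ℝ) R ∩ {r | g (r, k) ≤ 0}
    have hScl : IsClosed S := isClosed_Icc.inter (isClosed_le cgk continuous_const)
    have hSne : S.Nonempty := ⟨r₁, hr₁, hr₁'⟩
    have hSb : BddBelow S := ⟨0, fun x hx => hx.1.1⟩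
    have hb := hScl.csInf_mem hSne hSb
    set b := sInf S
    have hb2 : g (b, k) ≤ 0 := hb.2
    have hb0 : 0 < b := by
      rcases hb.1.1.eq_or_lt with h0 | h0
      · rw [← h0, hs.g0] at hb2; linarith
      · exact h0
    have hlt : ∀ r ∈ Ico 0 b, 0 < g (r, k) := by
      intro r hr
      by_contra hc
      exact absurd (csInf_le hSb ⟨⟨hr.1, hr.2.le.trans hb.1.2⟩, not_lt.mp hc⟩) (not_le.mpr hr.2)
    have hm := stepB b hb.1.2 (fun r hr => (hlt r ⟨hr.1.le, hr.2⟩).le)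
    have h1 := hm (a := b / 2) (b := b) ⟨by linarith, by linarith⟩ ⟨hb0.le, le_rfl⟩ (by linarith)
    have h2 : 0 < (b / 2) ^ δ * g (b / 2, k) :=
      mul_pos (Real.rpow_pos_of_pos (by linarith) _) (hlt _ ⟨by linarith, by linarith⟩)
    have h3 : b ^ δ * g (b, k) ≤ 0 := mul_nonpos_of_nonneg_of_nonpos (Real.rpow_nonneg hb0.le _) hb2
    simp only at h1
    linarith
  have hg' : ∀ r ∈ Ioo 0 R, 0 ≤ g (r, k) := fun r hr => (stepC r ⟨hr.1.le, hr.2.le⟩).le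
  exact ⟨stepC, stepA R le_rfl hg', stepB R le_rfl hg'⟩


lemma prufer {r₀ r₁ A B ω : ℝ} (hr₁ : r₁ ∈ Ico r₀ 1) (hAB : A ≤ B) (F Z : ℝ × ℝ → ℝ)
    (hF : Continuous F) (hZ : Continuous Z) (p : ℝ → ℝ) (hp : Continuous p) (hp0 : ∀ r, 0 < p r)
    (q : ℝ × ℝ → ℝ) (hq : Continuous q)
    (dF : ∀ k ∈ Icc A B, ∀ r ∈ Ico r₀ 1, HasDerivAt (fun s => F (s, k)) (p r * Z (r, k)) r)
    (dZ : ∀ k ∈ Icc A B, ∀ r ∈ Ico r₀ 1, HasDerivAt (fun s => Z (s, k)) (-(q (r, k) * F (r, k))) r)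
    (h0 : ∀ k ∈ Icc A B, 0 < F (r₀, k) ∧ 0 ≤ Z (r₀, k))
    (hA : ∀ r ∈ Icc r₀ 1, 0 < F (r, A))
    (hpω : ∀ r ∈ Icc r₁ 1, ω ≤ p r) (hqω : ∀ r ∈ Icc r₁ 1, ω ≤ q (r, B))
    (hωπ : 2 * Real.pi ≤ ω * (1 - r₁))
    (a b : ℝ → ℝ) (ha : ContinuousOn a (Icc A B)) (hb : ContinuousOn b (Icc A B))
    (ha0 : ∀ k ∈ Icc A B, 0 < a k) (hb0 : ∀ k ∈ Icc A B, 0 < b k) :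
    ∃ k ∈ Icc A B, F (1, k) ≠ 0 ∧ F (1, k) * b k = Z (1, k) * a k := by
  have hr01 : r₀ < 1 := hr₁.1.trans_lt hr₁.2
  have sl : ∀ {f : ℝ × ℝ → ℝ}, Continuous f → ∀ k, Continuous fun s => f (s, k) := fun hf k =>
    hf.comp (by fun_prop : Continuous fun t : ℝ => (t, k))
  -- nonvanishing
  have hnv : ∀ k ∈ Icc A B, ∀ r ∈ Icc r₀ 1, 0 < F (r, k) ^ 2 + Z (r, k) ^ 2 := by
    intro k hk r hr
    have cp := hp
    have cq := sl hq k
    obtain ⟨C, hC⟩ := (isCompact_Icc (a := r₀) (b := 1)).exists_bound_of_continuousOn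
      (f := fun s => p s - q (s, k)) (by fun_prop)
    have hmono : MonotoneOn (fun s => (F (s, k) ^ 2 + Z (s, k) ^ 2) * Real.exp (C * s)) (Icc r₀ 1) := by
      apply monotoneOn_of_hasDerivWithinAt_nonneg (convex_Icc r₀ 1)
        (f' := fun r => (2 * F (r, k) * (p r * Z (r, k)) + 2 * Z (r, k) * (-(q (r, k) * F (r, k)))) * Real.exp (C * r)
          + (F (r, k) ^ 2 + Z (r, k) ^ 2) * (Real.exp (C * r) * C))
      · have := sl hF k
        have := sl hZ k
        fun_prop
      · intro x hx
        rw [interior_Icc] at hx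
        have h1 := (((dF k hk x ⟨hx.1.le, hx.2⟩).pow 2).add ((dZ k hk x ⟨hx.1.le, hx.2⟩).pow 2)).mul
          (((hasDerivAt_id x).const_mul C).exp)
        refine (h1.congr_deriv ?_).hasDerivWithinAt
        simp
      · intro x hx
        rw [interior_Icc] at hx
        have h1 := abs_le.mp (hC x ⟨hx.1.le, hx.2.le⟩)
        have he := Real.exp_pos (C * x)
        have : 0 ≤ 2 * F (x, k) * Z (x, k) * (p x - q (x, k)) + C * (F (x, k) ^ 2 + Z (x, k) ^ 2) := by
          nlinarith [mul_nonneg (sq_nonneg (F (x, k) + Z (x, k))) (by linarith [h1.1] : 0 ≤ C + (p x - q (x, k))),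
            mul_nonneg (sq_nonneg (F (x, k) - Z (x, k))) (by linarith [h1.2] : 0 ≤ C - (p x - q (x, k)))]
        nlinarith
    have h1 := hmono ⟨le_rfl, hr01.le⟩ hr hr.1
    have h2 : 0 < (F (r₀, k) ^ 2 + Z (r₀, k) ^ 2) * Real.exp (C * r₀) := by
      have := (h0 k hk).1
      positivity
    exact pos_of_mul_pos_left (h2.trans_le h1) (Real.exp_pos _).le
  -- complex form
  let z : ℝ × ℝ → ℂ := fun x => ⟨Z x, F x⟩
  have hz : Continuous z := by
    have : z = fun x => ((Z x : ℂ) + (F x : ℂ) * Complex.I) := by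
      ext x; exact (Complex.mk_eq_add_mul_I _ _)
    rw [this]; fun_prop
  let z' : ℝ × ℝ → ℂ := fun x => ⟨-(q x * F x), p x.1 * Z x⟩
  have hz' : Continuous z' := by
    have : z' = fun x => (((-(q x * F x) : ℝ) : ℂ) + ((p x.1 * Z x : ℝ) : ℂ) * Complex.I) := by
      ext x; exact (Complex.mk_eq_add_mul_I _ _)
    rw [this]; fun_prop
  have hz0 : ∀ k ∈ Icc A B, ∀ r ∈ Icc r₀ 1, z (r, k) ≠ 0 := by
    intro k hk r hr h
    have h1 := congrArg Complex.re h
    have h2 := congrArg Complex.im h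
    simp only [z, Complex.zero_re, Complex.zero_im] at h1 h2
    have := hnv k hk r hr
    rw [h1, h2] at this
    simp at this
  let pr : ℝ × ℝ → ℝ × ℝ := fun x => (projIcc r₀ 1 hr01.le x.1, projIcc A B hAB x.2)
  have hpr : Continuous pr := by
    have h1 : Continuous fun x : ℝ × ℝ => projIcc r₀ 1 hr01.le x.1 := continuous_projIcc.comp continuous_fst
    have h2 : Continuous fun x : ℝ × ℝ => projIcc A B hAB x.2 := continuous_projIcc.comp continuous_snd
    fun_prop
  have hprid : ∀ r ∈ Icc r₀ 1, ∀ k ∈ Icc A B, pr (r, k) = (r, k) := by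
    intro r hr k hk
    simp only [pr]; rw [projIcc_of_mem _ hr, projIcc_of_mem _ hk]
  let W : ℝ × ℝ → ℂ := fun x => z' (pr x) / z (pr x)
  have hW : Continuous W := (hz'.comp hpr).div (hz.comp hpr) fun x =>
    hz0 _ (Subtype.prop _) _ (Subtype.prop _)
  have hWk : ∀ k, Continuous fun s => W (s, k) := fun k =>
    hW.comp (by fun_prop : Continuous fun t : ℝ => (t, k))
  let Φ : ℝ × ℝ → ℂ := fun x => ∫ s in r₀..x.1, W (s, x.2)
  have hΦ : Continuous Φ := by
    have h1 : Continuous (fun q : (ℝ × ℝ) × ℝ => W (q.2, q.1.2)) :=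
      hW.comp (by fun_prop : Continuous fun q : (ℝ × ℝ) × ℝ => (q.2, q.1.2))
    exact intervalIntegral.continuous_parametric_intervalIntegral_of_continuous
        (f := fun (z : ℝ × ℝ) (t : ℝ) => W (t, z.2)) h1 continuous_fst
  have dΦ : ∀ r k, HasDerivAt (fun s => Φ (s, k)) (W (r, k)) r := fun r k =>
    intervalIntegral.integral_hasDerivAt_right ((hWk k).intervalIntegrable _ _)
      (hWk k).stronglyMeasurable.stronglyMeasurableAtFilter (hWk k).continuousAt
  have hΦ0 : ∀ k, Φ (r₀, k) = 0 := fun k => by simp [Φ]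
  have dz : ∀ k ∈ Icc A B, ∀ r ∈ Ico r₀ 1, HasDerivAt (fun s => z (s, k)) (z' (r, k)) r := by
    intro k hk r hr
    have h1 := (dZ k hk r hr).ofReal_comp.add ((dF k hk r hr).ofReal_comp.mul_const Complex.I)
    have e1 : (fun s => z (s, k)) = (fun s => ((Z (s, k) : ℝ) : ℂ)) + fun s => ((F (s, k) : ℝ) : ℂ) * Complex.I := by
      ext s; exact (Complex.mk_eq_add_mul_I _ _)
    rw [e1]
    exact h1.congr_deriv (Complex.mk_eq_add_mul_I _ _).symm
  have hexp : ∀ k ∈ Icc A B, ∀ r ∈ Icc r₀ 1, z (r, k) = z (r₀, k) * Complex.exp (Φ (r, k)) := by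
    intro k hk r hr
    have hc := constant_of_has_deriv_right_zero (a := r₀) (b := 1)
      (f := fun s => z (s, k) * Complex.exp (-Φ (s, k))) ?_ ?_ r hr
    · simp only [hΦ0, neg_zero, Complex.exp_zero, mul_one] at hc
      rw [← hc, mul_assoc, ← Complex.exp_add]; simp
    · have h1 : Continuous fun s => z (s, k) := hz.comp (by fun_prop : Continuous fun t : ℝ => (t, k))
      have h2 : Continuous fun s => Φ (s, k) := hΦ.comp (by fun_prop : Continuous fun t : ℝ => (t, k))
      fun_prop
    · intro x hx
      have h1 := (dz k hk x hx).mul ((dΦ x k).neg.cexp)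
      refine (h1.congr_deriv ?_).hasDerivWithinAt
      have h2 : W (x, k) = z' (x, k) / z (x, k) := by
        simp only [W]; rw [hprid x ⟨hx.1, hx.2.le⟩ k hk]
      have h3 := hz0 k hk x ⟨hx.1, hx.2.le⟩
      simp only [Pi.neg_apply]
      rw [h2]; field_simp; ring
  let θ : ℝ × ℝ → ℝ := fun x => Complex.arg (z (r₀, x.2)) + (Φ x).im
  have hRθ : ∀ k ∈ Icc A B, ∀ r ∈ Icc r₀ 1, ∃ R : ℝ, 0 < R ∧ F (r, k) = R * Real.sin (θ (r, k)) ∧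
      Z (r, k) = R * Real.cos (θ (r, k)) := by
    intro k hk r hr
    have h1 := hexp k hk r hr
    set z₀ := z (r₀, k) with hz₀
    have hn : 0 < ‖z₀‖ := norm_pos_iff.mpr (hz0 k hk r₀ ⟨le_rfl, hr01.le⟩)
    have h2 : z (r, k) = ((‖z₀‖ * Real.exp (Φ (r, k)).re : ℝ) : ℂ) * Complex.exp (θ (r, k) * Complex.I) := by
      rw [h1]
      conv_lhs => rw [← Complex.norm_mul_exp_arg_mul_I z₀, ← Complex.re_add_im (Φ (r, k))]
      simp only [θ]
      rw [← hz₀]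
      push_cast
      rw [add_mul, Complex.exp_add, Complex.exp_add]
      ring
    refine ⟨_, mul_pos hn (Real.exp_pos (Φ (r, k)).re), ?_, ?_⟩
    · have h3 := congrArg Complex.im h2
      rw [Complex.im_ofReal_mul, Complex.exp_ofReal_mul_I_im] at h3
      exact h3
    · have h3 := congrArg Complex.re h2
      rw [Complex.re_ofReal_mul, Complex.exp_ofReal_mul_I_re] at h3
      exact h3
  have hWim : ∀ k ∈ Icc A B, ∀ r ∈ Icc r₀ 1, (W (r, k)).im =
      (p r * Z (r, k) ^ 2 + q (r, k) * F (r, k) ^ 2) / (F (r, k) ^ 2 + Z (r, k) ^ 2) := by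
    intro k hk r hr
    simp only [W]; rw [hprid r hr k hk, Complex.div_im]
    have := hnv k hk r hr
    have e : Complex.normSq (z (r, k)) = F (r, k) ^ 2 + Z (r, k) ^ 2 := by
      rw [Complex.normSq_apply]; simp only [z]; ring
    rw [e]; simp only [z, z']; field_simp; ring
  have dθ : ∀ r k, HasDerivAt (fun s => θ (s, k)) (W (r, k)).im r := by
    intro r k
    have := (Complex.imCLM.hasFDerivAt.comp_hasDerivAt r (dΦ r k))
    exact this.const_add (Complex.arg (z (r₀, k)))
  have harg : ∀ k ∈ Icc A B, 0 < θ (r₀, k) ∧ θ (r₀, k) ≤ Real.pi / 2 := by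
    intro k hk
    simp only [θ, hΦ0, Complex.zero_im, add_zero]
    have h1 := h0 k hk
    constructor
    · have h2 : 0 ≤ Complex.arg (z (r₀, k)) := Complex.arg_nonneg_iff.mpr h1.1.le
      rcases h2.eq_or_lt with h | h
      · have := (Complex.arg_eq_zero_iff.mp h.symm).2
        simp only [z] at this; linarith
      · exact h
    · exact Complex.arg_le_pi_div_two_iff.mpr (Or.inl h1.2)
  have cθ1 : ContinuousOn (fun k => θ (1, k)) (Icc A B) := by
    intro k hk
    have h1 : z (r₀, k) ∈ Complex.slitPlane := by
      right; exact (h0 k hk).1.ne'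
    have h2 := (Complex.continuousAt_arg h1).comp
      (f := fun k => z (r₀, k)) (hz.comp (by fun_prop : Continuous fun t : ℝ => (r₀, t))).continuousAt
    have h3 : Continuous fun k => (Φ (1, k)).im :=
      Complex.continuous_im.comp (hΦ.comp (by fun_prop : Continuous fun t : ℝ => ((1:ℝ), t)))
    exact (h2.add h3.continuousAt).continuousWithinAt
  have kA : A ∈ Icc A B := ⟨le_rfl, hAB⟩
  have kB : B ∈ Icc A B := ⟨hAB, le_rfl⟩
  have m1 : (1:ℝ) ∈ Icc r₀ 1 := ⟨hr01.le, le_rfl⟩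
  -- at A
  have hθA : θ (1, A) < Real.pi := by
    by_contra hc
    push Not at hc
    have hcont : ContinuousOn (fun s => θ (s, A)) (Icc r₀ 1) := fun s _ =>
      (dθ s A).continuousAt.continuousWithinAt
    obtain ⟨s, hs, hsπ⟩ := intermediate_value_Icc hr01.le hcont
      ⟨(harg A kA).2.trans (by linarith [Real.pi_pos]), hc⟩
    obtain ⟨R, hR, h1, h2⟩ := hRθ A kA s hs
    have := hA s hs
    simp only at hsπ
    rw [h1, hsπ, Real.sin_pi] at this
    simp at this
  -- at B
  have hθB1 : 0 ≤ θ (r₁, B) := by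
    have := image_le_of_deriv_right_lt_deriv_boundary (a := r₀) (b := 1)
      (f := fun s => -θ (s, B)) (f' := fun s => -(W (s, B)).im) (B := fun _ => 0) (B' := fun _ => 0)
      (fun s _ => (dθ s B).continuousAt.neg.continuousWithinAt)
      (fun s _ => (dθ s B).neg.hasDerivWithinAt)
      (by linarith [(harg B kB).1])
      (fun s => hasDerivAt_const _ _) ?_ (x := r₁) ⟨hr₁.1, hr₁.2.le⟩
    · linarith
    · intro s hs hs0
      have hs' : s ∈ Icc r₀ 1 := ⟨hs.1, hs.2.le⟩
      have e : θ (s, B) = 0 := by linarith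
      obtain ⟨R, hR, h1, h2⟩ := hRθ B kB s hs'
      rw [e] at h1 h2
      simp only [Real.sin_zero, Real.cos_zero, mul_zero, mul_one] at h1 h2
      rw [hWim B kB s hs', h1, h2]
      have := hp0 s
      have : 0 < (p s * R ^ 2 + q (s, B) * 0 ^ 2) / (0 ^ 2 + R ^ 2) := by
        norm_num; positivity
      linarith
  have hθB : 2 * Real.pi ≤ θ (1, B) := by
    have hmono : MonotoneOn (fun s => θ (s, B) - ω * s) (Icc r₁ 1) := by
      apply monotoneOn_of_hasDerivWithinAt_nonneg (convex_Icc r₁ 1) (f' := fun s => (W (s, B)).im - ω)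
      · exact fun s _ => ((dθ s B).continuousAt.sub (by fun_prop)).continuousWithinAt
      · intro x hx
        exact (((dθ x B).sub ((hasDerivAt_id x).const_mul ω)).congr_deriv (by simp)).hasDerivWithinAt
      · intro x hx
        rw [interior_Icc] at hx
        have hx1 : x ∈ Icc r₁ 1 := ⟨hx.1.le, hx.2.le⟩
        have hx' : x ∈ Icc r₀ 1 := ⟨hr₁.1.trans hx.1.le, hx.2.le⟩
        rw [hWim B kB x hx', sub_nonneg, le_div_iff₀ (hnv B kB x hx')]
        nlinarith [mul_nonneg (sub_nonneg.mpr (hpω x hx1)) (sq_nonneg (Z (x, B))),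
          mul_nonneg (sub_nonneg.mpr (hqω x hx1)) (sq_nonneg (F (x, B)))]
    have := hmono ⟨le_rfl, hr₁.2.le⟩ ⟨hr₁.2.le, le_rfl⟩ hr₁.2.le
    simp only at this
    linarith
  -- conclusion
  let β : ℝ → ℝ := fun k => Real.arctan (a k / b k)
  have hβ : ContinuousOn β (Icc A B) :=
    Real.continuous_arctan.comp_continuousOn (ha.div hb fun k hk => (hb0 k hk).ne')
  have hβ1 : ∀ k ∈ Icc A B, 0 < β k := fun k hk => Real.arctan_pos.mpr (div_pos (ha0 k hk) (hb0 k hk))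
  obtain ⟨k, hk, hkπ⟩ := intermediate_value_Icc hAB (cθ1.sub hβ) (show Real.pi ∈ Icc _ _ from
    ⟨by have := hβ1 A kA; simp only [Pi.sub_apply]; linarith,
     by have := Real.arctan_lt_pi_div_two (a B / b B)
        simp only [Pi.sub_apply, β]; linarith [Real.pi_pos]⟩)
  have hfin : F (1, k) * b k = Z (1, k) * a k := by
    obtain ⟨R, hR, h1, h2⟩ := hRθ k hk 1 m1
    have e : θ (1, k) = β k + Real.pi := by simp only [Pi.sub_apply] at hkπ; linarith
    rw [h1, h2, e, Real.sin_add_pi, Real.cos_add_pi]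
    simp only [β]
    rw [Real.sin_arctan, Real.cos_arctan]
    have := (hb0 k hk).ne'
    field_simp
  refine ⟨k, hk, fun hF0 => ?_, hfin⟩
  rw [hF0, zero_mul] at hfin
  have hZ0 : Z (1, k) = 0 := by
    rcases mul_eq_zero.mp hfin.symm with h | h
    · exact h
    · exact absurd h (ha0 k hk).ne'
  have := hnv k hk 1 m1
  rw [hF0, hZ0] at this
  simp at this


lemma hasFDerivAt_norm_ne {E : Type*} [NormedAddCommGroup E] [InnerProductSpace ℝ E] {x : E}
    (hx : x ≠ 0) : HasFDerivAt (fun y : E => ‖y‖) ((‖x‖⁻¹) • innerSL ℝ x) x := by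
  have h1 := (hasStrictFDerivAt_norm_sq x).hasFDerivAt.sqrt (by positivity)
  have e : (fun y : E => √(‖y‖ ^ 2)) = fun y => ‖y‖ := by
    ext y; exact Real.sqrt_sq (norm_nonneg y)
  rw [e] at h1
  refine h1.congr_fderiv ?_
  rw [Real.sqrt_sq (norm_nonneg x), ← Nat.cast_smul_eq_nsmul ℝ, smul_smul]
  congr 1
  have : ‖x‖ ≠ 0 := norm_ne_zero_iff.mpr hx
  push_cast
  field_simp

/-- the derivative of `φ(|x|) P(x)` when the derivative of φ is β over r squared. -/
def radD {E : Type*} [NormedAddCommGroup E] [InnerProductSpace ℝ E]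
    (φ β : ℝ → ℝ) (P : E → ℂ) (P' : E → E →L[ℝ] ℂ) (x : E) : E →L[ℝ] ℂ :=
  φ ‖x‖ • P' x + ((β ‖x‖ / ‖x‖ ^ 3) • innerSL ℝ x).smulRight (P x)

lemma rad_C1 {E : Type*} [NormedAddCommGroup E] [InnerProductSpace ℝ E]
    {φ α β : ℝ → ℝ} {P : E → ℂ} {P' : E → E →L[ℝ] ℂ} {R C : ℝ}
    (hα : Continuous α) (hβ : Continuous β) (hφα : ∀ r, 0 < r → φ r = α r / r)
    (hφ : ∀ r ∈ Ioo 0 R, HasDerivAt φ (β r / r ^ 2) r)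
    (hP : ∀ x, HasFDerivAt P (P' x) x) (hP' : Continuous P')
    (hC : 0 ≤ C) (bP : ∀ x, ‖x‖ ≤ 1 → ‖P x‖ ≤ C * ‖x‖ ^ 3)
    (bP' : ∀ x, ‖x‖ ≤ 1 → ‖P' x‖ ≤ C * ‖x‖ ^ 2) :
    (∀ x ∈ ball (0:E) R, HasFDerivAt (fun y => φ ‖y‖ • P y) (radD φ β P P' x) x) ∧
      ContinuousOn (radD φ β P P') (ball (0:E) R) := by
  have hPc : Continuous P := continuous_iff_continuousAt.mpr fun x => (hP x).continuousAt
  have hP0 : P 0 = 0 := by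
    have := bP 0 (by simp); simpa using this
  have hP'0 : P' 0 = 0 := by
    have := bP' 0 (by simp); simpa using this
  have hD0 : radD φ β P P' 0 = 0 := by
    unfold radD
    rw [hP'0, hP0]
    ext y
    simp
  obtain ⟨M1, h1⟩ := (isCompact_Icc (a := (0:ℝ)) (b := 1)).exists_bound_of_continuousOn hα.continuousOn
  obtain ⟨M2, h2⟩ := (isCompact_Icc (a := (0:ℝ)) (b := 1)).exists_bound_of_continuousOn hβ.continuousOn
  have hM1 : 0 ≤ M1 := (norm_nonneg _).trans (h1 0 (by simp))
  have hM2 : 0 ≤ M2 := (norm_nonneg _).trans (h2 0 (by simp))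
  constructor
  · intro x hx
    by_cases hx0 : x = 0
    · subst hx0
      rw [hD0]
      apply Asymptotics.IsBigO.hasFDerivAt (n := 2) _ (by norm_num)
      apply Asymptotics.IsBigO.of_bound (M1 * C)
      filter_upwards [closedBall_mem_nhds (0:E) one_pos] with y hy
      rw [mem_closedBall_zero_iff] at hy
      by_cases hy0 : y = 0
      · simp [hy0, hP0]
      have hy1 : 0 < ‖y‖ := norm_pos_iff.mpr hy0
      rw [norm_smul, hφα _ hy1, norm_div, norm_norm, sub_zero, norm_pow, norm_norm]
      calc ‖α ‖y‖‖ / ‖y‖ * ‖P y‖ ≤ M1 / ‖y‖ * (C * ‖y‖ ^ 3) := by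
            gcongr
            · exact h1 _ ⟨hy1.le, hy⟩
            · exact bP y hy
        _ = M1 * C * ‖y‖ ^ 2 := by field_simp
    · have hx1 : 0 < ‖x‖ := norm_pos_iff.mpr hx0
      have d1 := (hφ ‖x‖ ⟨hx1, mem_ball_zero_iff.mp hx⟩).comp_hasFDerivAt x (hasFDerivAt_norm_ne hx0)
      have d2 := d1.smul (hP x)
      refine d2.congr_fderiv ?_
      unfold radD
      congr 2
      rw [smul_smul]
      congr 1
      field_simp
  · intro x hx
    by_cases hx0 : x = 0
    · subst hx0
      apply ContinuousAt.continuousWithinAt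
      unfold ContinuousAt
      rw [hD0]
      have hlim : Tendsto (fun y : E => (M1 * C + M2 * C) * ‖y‖) (nhds 0) (nhds 0) := by
        have : Continuous (fun y : E => (M1 * C + M2 * C) * ‖y‖) := by fun_prop
        simpa using this.tendsto 0
      refine squeeze_zero_norm' ?_ hlim
      filter_upwards [closedBall_mem_nhds (0:E) one_pos] with y hy
      rw [mem_closedBall_zero_iff] at hy
      by_cases hy0 : y = 0
      · simp [hy0, hD0]
      have hy1 : 0 < ‖y‖ := norm_pos_iff.mpr hy0
      unfold radD
      refine (norm_add_le _ _).trans ?_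
      rw [norm_smul, hφα _ hy1, norm_div, norm_norm, ContinuousLinearMap.norm_smulRight_apply, norm_smul,
        innerSL_apply_norm, norm_div, norm_pow, norm_norm]
      calc ‖α ‖y‖‖ / ‖y‖ * ‖P' y‖ + ‖β ‖y‖‖ / ‖y‖ ^ 3 * ‖y‖ * ‖P y‖
          ≤ M1 / ‖y‖ * (C * ‖y‖ ^ 2) + M2 / ‖y‖ ^ 3 * ‖y‖ * (C * ‖y‖ ^ 3) := by
            gcongr
            · exact h1 _ ⟨hy1.le, hy⟩
            · exact bP' y hy
            · exact h2 _ ⟨hy1.le, hy⟩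
            · exact bP y hy
        _ = _ := by field_simp
    · have hx1 : 0 < ‖x‖ := norm_pos_iff.mpr hx0
      have c1 : ContinuousAt (fun y : E => φ ‖y‖) x :=
        ContinuousAt.comp (f := fun y : E => ‖y‖) (hφ ‖x‖ ⟨hx1, mem_ball_zero_iff.mp hx⟩).continuousAt
          continuous_norm.continuousAt
      have c2 : ContinuousAt (fun y : E => β ‖y‖ / ‖y‖ ^ 3) x := by
        apply ContinuousAt.div
        · fun_prop
        · fun_prop
        · positivity
      have c3 : ContinuousAt (fun y : E => (β ‖y‖ / ‖y‖ ^ 3) • innerSL ℝ y) x :=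
        c2.smul (innerSL ℝ (E := E)).continuous.continuousAt
      have c4 : ContinuousAt (fun y : E => ((β ‖y‖ / ‖y‖ ^ 3) • innerSL ℝ y).smulRight (P y)) x := by
        have := (ContinuousLinearMap.smulRightL ℝ E ℂ).continuous.continuousAt.comp c3
        exact this.clm_apply hPc.continuousAt
      exact ((c1.smul hP'.continuousAt).add c4).continuousWithinAt


lemma hasFDerivAt_clm_pow {E : Type*} [NormedAddCommGroup E] [NormedSpace ℝ E] (ℓ : E →L[ℝ] ℂ)
    (j : ℕ) (x : E) :
    HasFDerivAt (fun y => ℓ y ^ (j + 1)) ((((j + 1 : ℕ) : ℂ) * ℓ x ^ j) • ℓ) x := by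
  have h1 := (ℓ.hasFDerivAt (x := x)).pow (j + 1)
  refine h1.congr_fderiv ?_
  ext y
  simp

lemma clm_pow_bound {E : Type*} [NormedAddCommGroup E] [NormedSpace ℝ E] (ℓ : E →L[ℝ] ℂ)
    (a b : ℕ) (hab : b ≤ a) (x : E) (hx : ‖x‖ ≤ 1) : ‖ℓ x ^ a‖ ≤ ‖ℓ‖ ^ a * ‖x‖ ^ b := by
  rw [norm_pow]
  calc ‖ℓ x‖ ^ a ≤ (‖ℓ‖ * ‖x‖) ^ a := by gcongr; exact ℓ.le_opNorm x
    _ = ‖ℓ‖ ^ a * ‖x‖ ^ a := mul_pow _ _ _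
    _ ≤ _ := by
      gcongr ?_ * ?_
      exact pow_le_pow_of_le_one (norm_nonneg _) hx hab

section radial
variable {E : Type*} [NormedAddCommGroup E] [InnerProductSpace ℝ E]

lemma rad_u {g G : ℝ → ℝ} (cg : Continuous g) (cG : Continuous G) (dg : ∀ r, HasDerivAt g (G r) r)
    (ℓ : E →L[ℝ] ℂ) (j : ℕ) :
    (∀ x ∈ ball (0:E) 2, HasFDerivAt (fun y => g ‖y‖ • ℓ y ^ (j + 5))
      (radD g (fun r => r ^ 2 * G r) (fun y => ℓ y ^ (j + 5))
        (fun y => (((j + 5 : ℕ) : ℂ) * ℓ y ^ (j + 4)) • ℓ) x) x) ∧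
    ContinuousOn (radD g (fun r => r ^ 2 * G r) (fun y => ℓ y ^ (j + 5))
        (fun y => (((j + 5 : ℕ) : ℂ) * ℓ y ^ (j + 4)) • ℓ)) (ball (0:E) 2) := by
  apply rad_C1 (α := fun r => r * g r) (C := (j + 5 : ℕ) * ‖ℓ‖ ^ (j + 5))
  · fun_prop
  · fun_prop
  · intro r hr; field_simp
  · intro r hr
    have : r ^ 2 * G r / r ^ 2 = G r := by have := hr.1.ne'; field_simp
    rw [this]; exact dg r
  · exact fun x => hasFDerivAt_clm_pow ℓ (j + 4) x
  · fun_prop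
  · positivity
  · intro x hx
    refine (clm_pow_bound ℓ (j + 5) 3 (by omega) x hx).trans ?_
    gcongr
    have : (1:ℝ) ≤ (j + 5 : ℕ) := by norm_cast; omega
    exact le_mul_of_one_le_left (by positivity) this
  · intro x hx
    rw [norm_smul, norm_mul, Complex.norm_natCast]
    have := clm_pow_bound ℓ (j + 4) 2 (by omega) x hx
    calc (j + 5 : ℕ) * ‖ℓ x ^ (j + 4)‖ * ‖ℓ‖ ≤ (j + 5 : ℕ) * (‖ℓ‖ ^ (j + 4) * ‖x‖ ^ 2) * ‖ℓ‖ := by gcongr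
      _ = _ := by ring

def fluxD (s ds g G T : ℝ → ℝ) (ℓ : E →L[ℝ] ℂ) (j : ℕ) (e x : E) : E →L[ℝ] ℂ :=
  radD (fun r => s r * g r) (fun r => r ^ 2 * (ds r * g r + s r * G r))
    (fun y => (((j + 5 : ℕ) : ℂ) * ℓ e) * ℓ y ^ (j + 4))
    (fun y => (((j + 5 : ℕ) : ℂ) * ℓ e) • ((((j + 4 : ℕ) : ℂ) * ℓ y ^ (j + 3)) • ℓ)) x +
  radD (fun r => s r * G r / r) (fun r => r * ds r * G r + s r * T r - s r * G r)
    (fun y => inner ℝ y e • ℓ y ^ (j + 5))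
    (fun y => inner ℝ y e • ((((j + 5 : ℕ) : ℂ) * ℓ y ^ (j + 4)) • ℓ) +
      ((innerSL ℝ e).smulRight (ℓ y ^ (j + 5)))) x

lemma rad_flux {s ds g G T : ℝ → ℝ} (cs : Continuous s) (cds : Continuous ds)
    (dds : ∀ r ∈ Ioo (0:ℝ) 1, HasDerivAt s (ds r) r)
    (cg : Continuous g) (cG : Continuous G) (dg : ∀ r, HasDerivAt g (G r) r)
    (cT : Continuous T) (dG : ∀ r ∈ Ioo (0:ℝ) 1, HasDerivAt G (T r / r) r)
    (ℓ : E →L[ℝ] ℂ) (j : ℕ) (e : E) :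
    (∀ x ∈ ball (0:E) 1, HasFDerivAt
      (fun y => (s ‖y‖ : ℂ) * fderiv ℝ (fun y => g ‖y‖ • ℓ y ^ (j + 5)) y e)
      (fluxD s ds g G T ℓ j e x) x) ∧
    ContinuousOn (fluxD s ds g G T ℓ j e) (ball (0:E) 1) := by
  have h1 := rad_C1 (E := E) (α := fun r => r * (s r * g r)) (φ := fun r => s r * g r)
    (β := fun r => r ^ 2 * (ds r * g r + s r * G r))
    (P := fun y => (((j + 5 : ℕ) : ℂ) * ℓ e) * ℓ y ^ (j + 4))
    (P' := fun y => (((j + 5 : ℕ) : ℂ) * ℓ e) • ((((j + 4 : ℕ) : ℂ) * ℓ y ^ (j + 3)) • ℓ)) (R := 1)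
    (C := ‖((j + 5 : ℕ) : ℂ) * ℓ e‖ * ((j + 4 : ℕ) * ‖ℓ‖ ^ (j + 4)))
    (by fun_prop) (by fun_prop) (fun r hr => by field_simp)
    (fun r hr => by
      have : r ^ 2 * (ds r * g r + s r * G r) / r ^ 2 = ds r * g r + s r * G r := by
        have := hr.1.ne'; field_simp
      rw [this]; exact (dds r hr).mul (dg r))
    (fun x => (hasFDerivAt_clm_pow ℓ (j + 3) x).const_mul _)
    (by fun_prop) (by positivity)
    (fun x hx => by
      have := clm_pow_bound ℓ (j + 4) 3 (by omega) x hx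
      have h4 : (1:ℝ) ≤ (j + 4 : ℕ) := by norm_cast; omega
      rw [norm_mul, mul_assoc]
      gcongr
      refine this.trans ?_
      gcongr
      exact le_mul_of_one_le_left (by positivity) h4)
    (fun x hx => by
      rw [norm_smul, norm_smul, norm_mul ((j + 4 : ℕ) : ℂ), Complex.norm_natCast]
      have := clm_pow_bound ℓ (j + 3) 2 (by omega) x hx
      calc ‖((j + 5 : ℕ) : ℂ) * ℓ e‖ * ((j + 4 : ℕ) * ‖ℓ x ^ (j + 3)‖ * ‖ℓ‖)
          ≤ ‖((j + 5 : ℕ) : ℂ) * ℓ e‖ * ((j + 4 : ℕ) * (‖ℓ‖ ^ (j + 3) * ‖x‖ ^ 2) * ‖ℓ‖) := by gcongr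
      _ = _ := by ring)
  have h2 := rad_C1 (E := E) (α := fun r => s r * G r) (φ := fun r => s r * G r / r)
    (β := fun r => r * ds r * G r + s r * T r - s r * G r)
    (P := fun y => inner ℝ y e • ℓ y ^ (j + 5))
    (P' := fun y => inner ℝ y e • ((((j + 5 : ℕ) : ℂ) * ℓ y ^ (j + 4)) • ℓ) +
      ((innerSL ℝ e).smulRight (ℓ y ^ (j + 5)))) (R := 1)
    (C := (j + 6 : ℕ) * ‖e‖ * ‖ℓ‖ ^ (j + 5))
    (by fun_prop) (by fun_prop) (fun r hr => rfl)
    (fun r hr => by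
      have hr0 := hr.1.ne'
      refine ((((dds r hr).mul (dG r hr)).div (hasDerivAt_id r) hr0)).congr_deriv ?_
      simp only [id, Pi.mul_apply]
      field_simp)
    (fun x => by
      have d1 : HasFDerivAt (fun y : E => inner ℝ y e) (innerSL ℝ e) x := by
        have := (innerSL ℝ e).hasFDerivAt (x := x)
        refine this.congr_of_eventuallyEq (Eventually.of_forall fun y => ?_)
        simp [real_inner_comm]
      exact d1.smul (hasFDerivAt_clm_pow ℓ (j + 4) x))
    (by
      have c1 : Continuous fun y : E => ((innerSL ℝ e).smulRight (ℓ y ^ (j + 5))) := by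
        have := ((ContinuousLinearMap.smulRightL ℝ E ℂ) (innerSL ℝ e)).continuous
        exact this.comp (by fun_prop : Continuous fun y => ℓ y ^ (j + 5))
      fun_prop) (by positivity)
    (fun x hx => by
      have := clm_pow_bound ℓ (j + 5) 3 (by omega) x hx
      have h4 : (1:ℝ) ≤ (j + 6 : ℕ) := by norm_cast; omega
      rw [norm_smul]
      have hi : ‖inner ℝ x e‖ ≤ ‖e‖ := (norm_inner_le_norm x e).trans
        (mul_le_of_le_one_left (norm_nonneg _) hx)
      calc ‖inner ℝ x e‖ * ‖ℓ x ^ (j + 5)‖ ≤ ‖e‖ * (‖ℓ‖ ^ (j + 5) * ‖x‖ ^ 3) := by gcongr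
        _ = 1 * ‖e‖ * ‖ℓ‖ ^ (j + 5) * ‖x‖ ^ 3 := by ring
        _ ≤ _ := by gcongr)
    (fun x hx => by
      have b1 := clm_pow_bound ℓ (j + 4) 2 (by omega) x hx
      have b2 := clm_pow_bound ℓ (j + 5) 2 (by omega) x hx
      have hi : ‖inner ℝ x e‖ ≤ ‖e‖ := (norm_inner_le_norm x e).trans
        (mul_le_of_le_one_left (norm_nonneg _) hx)
      refine (norm_add_le _ _).trans ?_
      rw [norm_smul, norm_smul, norm_mul, Complex.norm_natCast, ContinuousLinearMap.norm_smulRight_apply,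
        innerSL_apply_norm]
      calc ‖inner ℝ x e‖ * ((j + 5 : ℕ) * ‖ℓ x ^ (j + 4)‖ * ‖ℓ‖) + ‖e‖ * ‖ℓ x ^ (j + 5)‖
          ≤ ‖e‖ * ((j + 5 : ℕ) * (‖ℓ‖ ^ (j + 4) * ‖x‖ ^ 2) * ‖ℓ‖) + ‖e‖ * (‖ℓ‖ ^ (j + 5) * ‖x‖ ^ 2) := by gcongr
        _ = _ := by push_cast; ring)
  have hu := rad_u cg cG dg ℓ j
  refine ⟨fun x hx => ?_, h1.2.add h2.2⟩
  have d := (h1.1 x hx).add (h2.1 x hx)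
  refine d.congr_of_eventuallyEq ?_
  filter_upwards [isOpen_ball.mem_nhds hx] with y hy
  rw [(hu.1 y (ball_subset_ball (by norm_num) hy)).fderiv]
  simp only [radD, Pi.add_apply, add_apply, smul_apply,
    ContinuousLinearMap.smulRight_apply, innerSL_apply_apply, Complex.real_smul, smul_eq_mul]
  by_cases hy0 : y = 0
  · simp [hy0]
  have hy1 : (‖y‖ : ℂ) ≠ 0 := by simpa using hy0
  push_cast
  field_simp
end radial


/-- The product of r and the derivative of G, expressed through the ODE. -/
def radT (σ dσ n : ℝ → ℝ) (m p : ℕ) (k : ℝ) (g G : ℝ × ℝ → ℝ) (r : ℝ) : ℝ :=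
  -((p + 1) * G (r, k)) - r * dσ r * G (r, k) / σ r - (m * dσ r + k ^ 2 * r * n r ^ 2) * g (r, k) / σ r

lemma slice_cont {f : ℝ × ℝ → ℝ} (hf : Continuous f) (k : ℝ) : Continuous fun s => f (s, k) :=
  hf.comp (by fun_prop : Continuous fun t : ℝ => (t, k))

lemma RadSol.cT {σ dσ n : ℝ → ℝ} (h : RadCoef σ dσ n) {m p : ℕ} {K : ℝ} {g G : ℝ × ℝ → ℝ}
    (hs : RadSol σ dσ n m p K g G) (k : ℝ) : Continuous (radT σ dσ n m p k g G) := by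
  have c1 := hs.cg
  have c2 := hs.cG
  have c3 := h.cσ
  have c4 := h.cdσ
  have c5 := h.cn
  have c6 := fun r => (h.pos r).ne'
  have c7 : Continuous fun r => r * dσ r * G (r, k) / σ r := Continuous.div (by fun_prop) c3 c6
  have c8 : Continuous fun r => (m * dσ r + k ^ 2 * r * n r ^ 2) * g (r, k) / σ r :=
    Continuous.div (by fun_prop) c3 c6
  unfold radT
  fun_prop

lemma RadSol.dG2 {σ dσ n : ℝ → ℝ} (h : RadCoef σ dσ n) {m p : ℕ} {K : ℝ} {g G : ℝ × ℝ → ℝ}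
    (hs : RadSol σ dσ n m p K g G) {k : ℝ} (hk : k ∈ Icc (0:ℝ) K) {r : ℝ} (hr : r ∈ Ioo (0:ℝ) 1) :
    HasDerivAt (fun s => G (s, k)) (radT σ dσ n m p k g G r / r) r := by
  have hr0 : r ≠ 0 := hr.1.ne'
  have hσ0 : σ r ≠ 0 := (h.pos r).ne'
  have d1 := hs.dG k hk r hr
  have d2 := (hasDerivAt_pow (p + 1) r).mul (h.der r hr)
  have d3 := d1.div d2 (by simp only [Pi.mul_apply]; positivity)
  have d4 := d3.congr_of_eventuallyEq (f₁ := fun s => G (s, k)) (by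
    filter_upwards [isOpen_Ioo.mem_nhds hr] with s hs'
    have h1 : s ≠ 0 := hs'.1.ne'
    have h2 : σ s ≠ 0 := (h.pos s).ne'
    simp only [Pi.mul_apply, Pi.div_apply]
    field_simp)
  refine d4.congr_deriv ?_
  simp only [Pi.mul_apply, radT, Nat.add_sub_cancel]
  push_cast
  field_simp
  ring

section radialPDE
variable {N : ℕ}

lemma rad_smooth {g G T : ℝ → ℝ}
    (cg : Continuous g) (cG : Continuous G) (dg : ∀ r, HasDerivAt g (G r) r)
    (cT : Continuous T) (dG : ∀ r ∈ Ioo (0:ℝ) 1, HasDerivAt G (T r / r) r)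
    (ℓ : EuclideanSpace ℝ (Fin N) →L[ℝ] ℂ) (j : ℕ) :
    ContDiffOn ℝ 2 (fun y => g ‖y‖ • ℓ y ^ (j + 5)) (ball (0 : EuclideanSpace ℝ (Fin N)) 1) ∧
    ContDiffOn ℝ 1 (fun y => g ‖y‖ • ℓ y ^ (j + 5)) (closedBall (0 : EuclideanSpace ℝ (Fin N)) 1) := by
  have hu := rad_u cg cG dg ℓ j
  have key : ∀ (f : EuclideanSpace ℝ (Fin N) → ℂ) (D : EuclideanSpace ℝ (Fin N) → (EuclideanSpace ℝ (Fin N) →L[ℝ] ℂ)) (R : ℝ),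
      (∀ x ∈ ball (0 : EuclideanSpace ℝ (Fin N)) R, HasFDerivAt f (D x) x) →
      ContinuousOn D (ball (0 : EuclideanSpace ℝ (Fin N)) R) →
      ContDiffOn ℝ 1 f (ball (0 : EuclideanSpace ℝ (Fin N)) R) := by
    intro f D R h1 h2
    rw [show (1 : WithTop ℕ∞) = 0 + 1 from rfl, contDiffOn_succ_iff_fderiv_of_isOpen isOpen_ball]
    refine ⟨fun x hx => (h1 x hx).differentiableAt.differentiableWithinAt, by simp, ?_⟩
    rw [contDiffOn_zero]
    exact h2.congr fun x hx => (h1 x hx).fderiv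
  constructor
  · rw [show (2 : WithTop ℕ∞) = 1 + 1 from rfl, contDiffOn_succ_iff_fderiv_of_isOpen isOpen_ball]
    refine ⟨fun x hx => (hu.1 x (ball_subset_ball (by norm_num) hx)).differentiableAt.differentiableWithinAt,
      by simp, ?_⟩
    rw [contDiffOn_clm_apply]
    intro e
    have hf := rad_flux (s := fun _ => 1) (ds := fun _ => 0) continuous_const continuous_const
      (fun r _ => hasDerivAt_const r 1) cg cG dg cT dG ℓ j e
    have := key _ _ 1 hf.1 hf.2
    simpa using this
  · exact (key _ _ 2 hu.1 hu.2).mono (closedBall_subset_ball (by norm_num))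

lemma rad_normal {g G : ℝ → ℝ}
    (cg : Continuous g) (cG : Continuous G) (dg : ∀ r, HasDerivAt g (G r) r)
    (ℓ : EuclideanSpace ℝ (Fin N) →L[ℝ] ℂ) (j : ℕ) (x : EuclideanSpace ℝ (Fin N)) (hx : ‖x‖ = 1) :
    fderivWithin ℝ (fun y => g ‖y‖ • ℓ y ^ (j + 5)) (closedBall (0 : EuclideanSpace ℝ (Fin N)) 1) x x
      = ((G 1 + (j + 5 : ℕ) * g 1 : ℝ) : ℂ) * ℓ x ^ (j + 5) := by
  have hu := (rad_u cg cG dg ℓ j).1 x (by rw [mem_ball_zero_iff, hx]; norm_num)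
  have hud : UniqueDiffWithinAt ℝ (closedBall (0 : EuclideanSpace ℝ (Fin N)) 1) x := by
    apply uniqueDiffOn_convex (convex_closedBall _ _) ⟨0, by simp [interior_closedBall]⟩
    simp [hx]
  rw [hu.hasFDerivWithinAt.fderivWithin hud]
  simp only [radD, add_apply, smul_apply, ContinuousLinearMap.smulRight_apply, innerSL_apply_apply,
    Complex.real_smul, smul_eq_mul, hx, real_inner_self_eq_norm_sq]
  push_cast
  ring

lemma rad_pde {σ dσ n g G : ℝ → ℝ} {T : ℝ → ℝ} {k : ℝ} {p : ℕ}
    (cs : Continuous σ) (cds : Continuous dσ) (hσ : ∀ r, 0 < σ r)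
    (dds : ∀ r ∈ Ioo (0:ℝ) 1, HasDerivAt σ (dσ r) r)
    (cg : Continuous g) (cG : Continuous G) (dg : ∀ r, HasDerivAt g (G r) r)
    (cT : Continuous T) (dG : ∀ r ∈ Ioo (0:ℝ) 1, HasDerivAt G (T r / r) r)
    (ℓ : EuclideanSpace ℝ (Fin N) →L[ℝ] ℂ) (j : ℕ) (hp : p + 2 = 2 * (j + 5) + N)
    (hT : ∀ r, T r = -((p + 1) * G r) - r * dσ r * G r / σ r
      - ((j + 5 : ℕ) * dσ r + k ^ 2 * r * n r ^ 2) * g r / σ r)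
    (hℓ : ∑ i, ℓ (EuclideanSpace.single i 1) ^ 2 = 0)
    (x : EuclideanSpace ℝ (Fin N)) (hx : x ∈ ball (0 : EuclideanSpace ℝ (Fin N)) 1) :
    divSigmaGrad N σ (fun y => g ‖y‖ • ℓ y ^ (j + 5)) x
      + (k : ℂ) ^ 2 * (n ‖x‖ : ℂ) ^ 2 * (g ‖x‖ • ℓ x ^ (j + 5)) = 0 := by
  have e1 : ∑ i, (x i : ℂ) * ℓ (EuclideanSpace.single i 1) = ℓ x := by
    conv_rhs => rw [← (EuclideanSpace.basisFun (Fin N) ℝ).sum_repr x]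
    simp [map_sum]
  have e2 : ∑ i, (x i : ℂ) ^ 2 = (‖x‖ : ℂ) ^ 2 := by
    have := EuclideanSpace.real_norm_sq_eq x
    exact_mod_cast this.symm
  unfold divSigmaGrad
  rw [Finset.sum_congr rfl fun i _ => by
    rw [((rad_flux cs cds dds cg cG dg cT dG ℓ j (EuclideanSpace.single i 1)).1 x hx).fderiv]]
  by_cases hx0 : x = 0
  · subst hx0
    simp [fluxD, radD]
  have hx1 : 0 < ‖x‖ := norm_pos_iff.mpr hx0
  have hxc : (‖x‖ : ℂ) ≠ 0 := by simpa using hx0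
  have hsc : (σ ‖x‖ : ℂ) ≠ 0 := by simpa using (hσ ‖x‖).ne'
  set r := ‖x‖ with hr
  set L := ℓ x with hL
  set M : ℂ := (j : ℂ) + 5 with hM
  have hterm : ∀ i, (fluxD σ dσ g G T ℓ j (EuclideanSpace.single i 1) x) (EuclideanSpace.single i 1)
      = (M * (M - 1) * σ r * g r * L ^ (j + 3)) * ℓ (EuclideanSpace.single i 1) ^ 2
      + (M * L ^ (j + 4) * (dσ r * g r + σ r * G r) / r + M * L ^ (j + 4) * σ r * G r / r)
          * ((x i : ℂ) * ℓ (EuclideanSpace.single i 1))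
      + ((r * dσ r * G r + σ r * T r - σ r * G r) / r ^ 3 * L ^ (j + 5)) * (x i : ℂ) ^ 2
      + σ r * G r / r * L ^ (j + 5) := by
    intro i
    simp only [fluxD, radD, add_apply, smul_apply, ContinuousLinearMap.smulRight_apply, innerSL_apply_apply,
      Complex.real_smul, smul_eq_mul, ← hr, ← hL]
    have : inner ℝ x (EuclideanSpace.single i (1:ℝ)) = x i := by
      rw [EuclideanSpace.inner_single_right]; simp
    rw [this]
    have : inner ℝ (EuclideanSpace.single i (1:ℝ)) (EuclideanSpace.single i (1:ℝ)) = (1:ℝ) := by simp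
    rw [this]
    push_cast
    rw [hM]
    field_simp
    ring
  rw [Finset.sum_congr rfl fun i _ => hterm i]
  simp only [Finset.sum_add_distrib, ← Finset.mul_sum, hℓ, e1, e2]
  simp only [Finset.sum_const, Finset.card_univ, Fintype.card_fin, nsmul_eq_mul, Complex.real_smul]
  rw [hT]
  have hp' : (p : ℂ) = 2 * M + N - 2 := by
    have : ((p + 2 : ℕ) : ℂ) = ((2 * (j + 5) + N : ℕ) : ℂ) := by rw [hp]
    push_cast at this
    rw [hM]; linear_combination this
  push_cast
  rw [hp', ← hM]
  field_simp
  ring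
end radialPDE


lemma radCoef_one : RadCoef (fun _ => 1) (fun _ => 0) (fun _ => 1) where
  cσ := continuous_const
  cdσ := continuous_const
  cn := continuous_const
  pos := fun _ => one_pos
  der := fun r _ => hasDerivAt_const r 1

set_option maxHeartbeats 1000000 in
lemma eigen_step {σ dσ n : ℝ → ℝ} (h : RadCoef σ dσ n) (hdσ : ∀ r ∈ Ioo (0:ℝ) 1, dσ r ≤ 0)
    {M₁ M₂ S s₀ α b η r₁ e ω : ℝ} (hs₀ : 0 < s₀)
    (hb : ∀ r ∈ Icc (0:ℝ) 1, s₀ ≤ σ r ∧ σ r ≤ S ∧ M₁ * σ r ≤ n r ^ 2 ∧ n r ^ 2 ≤ M₂ * σ r)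
    (hM₁ : 0 < M₁)
    (hα : 0 < α) (hα2 : α ^ 2 * M₂ = 1) (hb0 : 0 < b) (hb1 : b < 1) (hαb : α ≤ b)
    (hη : η ∈ Ioo (0:ℝ) 1) (hηb : η ^ 2 = 1 - b ^ 2)
    (hr₁ : r₁ ∈ Ico α 1) (he : 0 < e) (hr₁e : 1 + 2 * e ≤ b ^ 2 * r₁ ^ 2 * M₁)
    {N : ℕ} (hN : N = 2 ∨ N = 3) (m p : ℕ) (hp : p + 2 = 2 * m + N) (hm : 1 ≤ m) (hme : 1 ≤ e * m)
    (hω1 : ω ≤ m / S) (hω2 : ω ≤ e * r₁ ^ 2 * s₀ * m) (hωπ : 2 * Real.pi ≤ ω * (1 - r₁)) :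
    ∃ (k K : ℝ) (g G f f' : ℝ × ℝ → ℝ), k ∈ Icc 0 K ∧ α * m ≤ k ∧ RadSol σ dσ n m p K g G ∧
      RadSol (fun _ => 1) (fun _ => 0) (fun _ => 1) m p K f f' ∧ g (1, k) ≠ 0 ∧
      (∀ r ∈ Icc (0:ℝ) 1, 0 < f (r, k)) ∧
      MonotoneOn (fun r => r ^ ((1 - η) * m) * f (r, k)) (Icc 0 1) ∧
      g (1, k) * (f' (1, k) + m * f (1, k)) = σ 1 * (G (1, k) + m * g (1, k)) * f (1, k) := by
  have hm0 : (0:ℝ) < m := by exact_mod_cast hm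
  have hm1 : (1:ℝ) ≤ m := by exact_mod_cast hm
  have hpm : (p:ℝ) - m = m + ((N - 2 : ℕ) : ℝ) := by
    have : p = m + (m + (N - 2)) := by omega
    rw [this]; push_cast; ring
  have hN1 : ((N - 2 : ℕ) : ℝ) ≤ 1 := by
    rcases hN with rfl | rfl <;> norm_num
  have hN0 : (0:ℝ) ≤ ((N - 2 : ℕ) : ℝ) := by positivity
  have hα1 : α < 1 := hr₁.1.trans_lt hr₁.2
  have hr₁0 : 0 < r₁ := hα.trans_le hr₁.1
  obtain ⟨g, G, hg⟩ := radSol_exists h m p (b * m) (by positivity)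
  obtain ⟨f, f', hf⟩ := radSol_exists radCoef_one m p (b * m) (by positivity)
  have hAB : α * m ≤ b * m := by gcongr
  have hk0 : ∀ k ∈ Icc (α * m) (b * m), k ∈ Icc 0 (b * m) := fun k hk =>
    ⟨le_trans (by positivity) hk.1, hk.2⟩
  have hksq : ∀ k ∈ Icc (α * m) (b * m), k ^ 2 ≤ (b * m) ^ 2 := fun k hk => by
    have := (hk0 k hk).1
    have := hk.2
    gcongr
  have hσ0 := h.pos
  -- sign of f
  have posf : ∀ k ∈ Icc (α * m) (b * m), _ := fun k hk =>
    hf.pos radCoef_one (hk0 k hk) (fun r _ => le_rfl) (δ := (1 - η) * m) (R := 1)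
      (mul_pos (by linarith [hη.2]) hm0) (by nlinarith [hη.1]) (by nlinarith [hη.1]) le_rfl (by
        intro r hr
        have h1 := hksq k hk
        have h2 : r ^ 2 ≤ 1 := by nlinarith [hr.1, hr.2]
        have h3 : (1 + η) * m ≤ p - (1 - η) * m := by nlinarith
        have h4 : 0 ≤ (1 - η) * m := (mul_pos (by linarith [hη.2]) hm0).le
        calc k ^ 2 * r ^ 2 * 1 ^ 2 ≤ (b * m) ^ 2 * 1 * 1 ^ 2 := by gcongr
          _ = (1 - η) * m * ((1 + η) * m) := by
            have : b ^ 2 = 1 - η ^ 2 := by linarith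
            rw [mul_pow, this]; ring
          _ ≤ _ := by rw [mul_one]; gcongr)
  -- sign of g near 0
  have posg : ∀ k ∈ Icc (α * m) (b * m), _ := fun k hk =>
    hg.pos h (hk0 k hk) hdσ (δ := m) (R := α) hm0 le_rfl (by linarith) hα1.le (by
      intro r hr
      have h1 := hksq k hk
      have h2 : r ^ 2 ≤ α ^ 2 := by nlinarith [hr.1, hr.2]
      obtain ⟨-, -, -, h3⟩ := hb r ⟨hr.1.le, (hr.2.trans hα1).le⟩
      have h4 : (b * m) ^ 2 ≤ (m:ℝ) ^ 2 := by
        have : b * m ≤ 1 * m := by gcongr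
        rw [one_mul] at this
        gcongr
      calc k ^ 2 * r ^ 2 * n r ^ 2 ≤ (m:ℝ) ^ 2 * α ^ 2 * (M₂ * σ r) := by
            have := h1.trans h4
            gcongr
        _ = m * m * σ r := by linear_combination (m:ℝ) ^ 2 * σ r * hα2
        _ ≤ _ := by
          have := hσ0 r
          gcongr
          linarith)
  have posA := hg.pos h (hk0 (α * m) ⟨le_rfl, hAB⟩) hdσ (δ := m) (R := 1) hm0 le_rfl (by linarith) le_rfl (by
      intro r hr
      have h2 : r ^ 2 ≤ 1 := by nlinarith [hr.1, hr.2]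
      obtain ⟨-, -, -, h3⟩ := hb r ⟨hr.1.le, hr.2.le⟩
      calc (α * m) ^ 2 * r ^ 2 * n r ^ 2 ≤ (α * m) ^ 2 * 1 * (M₂ * σ r) := by gcongr
        _ = m * m * σ r := by linear_combination (m:ℝ) ^ 2 * σ r * hα2
        _ ≤ _ := by
          have := hσ0 r
          gcongr
          linarith)
  have hN' : N - 1 = (N - 2) + 1 := by rcases hN with rfl | rfl <;> rfl
  have cg := hg.cg
  have cG := hg.cG
  have cσ := h.cσ
  have cn := h.cn
  have htpos : ∀ r : ℝ, 0 < max r α := fun r => lt_max_of_lt_right hα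
  have cmax : Continuous fun r : ℝ => max r α := by fun_prop
  obtain ⟨k, hk, hk1, hk2⟩ := prufer (r₀ := α) (r₁ := r₁) (A := α * m) (B := b * m) (ω := ω) hr₁ hAB
    (fun z => z.1 ^ m * g z)
    (fun z => z.1 ^ (p - m) * (σ z.1 * (z.1 * G z + m * g z)) / m)
    (by fun_prop) (by fun_prop)
    (fun r => m / (σ r * (max r α) ^ (N - 1)))
    (Continuous.div continuous_const (by fun_prop) fun r => (mul_pos (hσ0 r) (pow_pos (htpos r) _)).ne')
    (fun r => div_pos hm0 (mul_pos (hσ0 r) (pow_pos (htpos r) _)))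
    (fun z => (max z.1 α) ^ (N - 1) / (m * (max z.1 α) ^ 2)
      * (z.2 ^ 2 * z.1 ^ 2 * n z.1 ^ 2 - m * (p - m) * σ z.1))
    (by
      have : Continuous fun z : ℝ × ℝ => (max z.1 α) ^ (N - 1) / (m * (max z.1 α) ^ 2) := by
        apply Continuous.div (by fun_prop) (by fun_prop)
        intro z
        exact (mul_pos hm0 (pow_pos (htpos _) _)).ne'
      fun_prop)
    (by
      intro k hk r hr
      have hr0 : 0 < r := hα.trans_le hr.1
      have := hσ0 r
      refine ((hasDerivAt_pow m r).mul (hg.dg r k)).congr_deriv ?_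
      simp only [max_eq_left hr.1]
      rw [show p - m = (m - 1) + (N - 1) by omega, pow_add]
      have e4 : r ^ m = r ^ (m - 1) * r := by
        rw [← pow_succ]; congr 1; omega
      rw [e4]
      field_simp
      ring)
    (by
      intro k hk r hr
      have hr0 : 0 < r := hα.trans_le hr.1
      have d := (hg.W_deriv h (hk0 k hk) ⟨hr0, hr.2⟩ (m:ℝ)).div_const (m:ℝ)
      have ee : (p:ℝ) - m = ((p - m : ℕ) : ℝ) := by
        rw [Nat.cast_sub]; omega
      have ee1 : (p:ℝ) - m - 1 = ((p - m - 1 : ℕ) : ℝ) := by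
        rw [ee, Nat.cast_sub (m := 1) (by omega)]; norm_num
      rw [ee1] at d
      simp only [ee, Real.rpow_natCast] at d ⊢
      refine d.congr_deriv ?_
      simp only [max_eq_left hr.1]
      have e3 : r ^ (p - m - 1) * r ^ 2 = r ^ m * r ^ (N - 1) := by
        rw [← pow_add, ← pow_add]; congr 1; omega
      field_simp
      linear_combination (g (r, k) * (m * ((p - m : ℕ) : ℝ) * σ r - k ^ 2 * r ^ 2 * n r ^ 2)) * e3)
    (by
      intro k hk
      have h1 := (posg k hk).1 α ⟨hα.le, le_rfl⟩
      have h2 := (posg k hk).2.1 α ⟨hα.le, le_rfl⟩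
      have := hσ0 α
      refine ⟨by positivity, by positivity⟩)
    (by
      intro r hr
      have h1 := posA.1 r ⟨hα.le.trans hr.1, hr.2⟩
      have : 0 < r := hα.trans_le hr.1
      positivity)
    (by
      intro r hr
      have hr0 : 0 < r := hr₁0.trans_le hr.1
      obtain ⟨-, h1, -, -⟩ := hb r ⟨hr0.le, hr.2⟩
      have hσr := hσ0 r
      refine hω1.trans ?_
      simp only [max_eq_left (hr₁.1.trans hr.1)]
      gcongr
      calc σ r * r ^ (N - 1) ≤ S * 1 := by
            have := hσr.le.trans h1
            gcongr
            exact pow_le_one₀ hr0.le hr.2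
        _ = S := mul_one S)
    (by
      intro r hr
      have hr0 : 0 < r := hr₁0.trans_le hr.1
      obtain ⟨h0, h1, h2, -⟩ := hb r ⟨hr0.le, hr.2⟩
      have hσr := hσ0 r
      refine hω2.trans ?_
      simp only [max_eq_left (hr₁.1.trans hr.1)]
      have h5 : e * m ^ 2 * s₀ ≤ (b * m) ^ 2 * r ^ 2 * n r ^ 2 - m * (p - m) * σ r := by
        have h6 : (1 + 2 * e) * (m ^ 2 * σ r) ≤ (b * m) ^ 2 * r ^ 2 * n r ^ 2 := by
          calc (1 + 2 * e) * (m ^ 2 * σ r) ≤ (b ^ 2 * r₁ ^ 2 * M₁) * (m ^ 2 * σ r) := by gcongr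
            _ = (b * m) ^ 2 * r₁ ^ 2 * (M₁ * σ r) := by ring
            _ ≤ _ := by
              have := hr.1
              gcongr
        have h7 : m * (p - m) * σ r ≤ (1 + e) * (m ^ 2 * σ r) := by
          have : (p:ℝ) - m ≤ (1 + e) * m := by linarith
          calc m * (p - m) * σ r ≤ m * ((1 + e) * m) * σ r := by gcongr
            _ = _ := by ring
        have h8 : e * m ^ 2 * s₀ ≤ e * m ^ 2 * σ r := by gcongr
        linarith
      have h6 : r₁ ^ 2 / m ≤ r ^ (N - 1) / (m * r ^ 2) := by
        rw [div_le_div_iff₀ hm0 (by positivity)]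
        have h9 : r₁ ^ 2 * r ^ 2 ≤ r ^ (N - 1) := by
          calc r₁ ^ 2 * r ^ 2 ≤ 1 * r ^ (N - 1) := by
                gcongr ?_ * ?_
                · exact pow_le_one₀ hr₁0.le hr₁.2.le
                · apply pow_le_pow_of_le_one hr0.le hr.2
                  omega
            _ = _ := one_mul _
        calc r₁ ^ 2 * (m * r ^ 2) = r₁ ^ 2 * r ^ 2 * m := by ring
          _ ≤ r ^ (N - 1) * m := by gcongr
      calc e * r₁ ^ 2 * s₀ * m = r₁ ^ 2 / m * (e * m ^ 2 * s₀) := by field_simp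
        _ ≤ _ := by gcongr)
    hωπ
    (fun k => f (1, k)) (fun k => (f' (1, k) + m * f (1, k)) / m)
    (by have := hf.cg; fun_prop) (by have := hf.cg; have := hf.cG; fun_prop)
    (fun k hk => (posf k hk).1 1 ⟨zero_le_one, le_rfl⟩)
    (fun k hk => by
      have h1 := (posf k hk).1 1 ⟨zero_le_one, le_rfl⟩
      have h2 := (posf k hk).2.1 1 ⟨zero_le_one, le_rfl⟩
      have h3 : 0 < η * m * f (1, k) := by have := hη.1; positivity
      apply div_pos _ hm0
      linarith)
  refine ⟨k, b * m, g, G, f, f', hk0 k hk, hk.1, hg, hf, by simpa using hk1, (posf k hk).1,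
    (posf k hk).2.2, ?_⟩
  simp only [one_pow, one_mul] at hk2
  field_simp at hk2
  linear_combination hk2


lemma exists_ell {N : ℕ} (hN : N = 2 ∨ N = 3) :
    ∃ ℓ : EuclideanSpace ℝ (Fin N) →L[ℝ] ℂ, ∑ i, ℓ (EuclideanSpace.single i 1) ^ 2 = 0 ∧
      ∃ x : EuclideanSpace ℝ (Fin N), ‖x‖ = 1 ∧ ℓ x ≠ 0 := by
  rcases hN with rfl | rfl
  · refine ⟨Complex.ofRealCLM.comp (EuclideanSpace.proj 0)
      + Complex.I • Complex.ofRealCLM.comp (EuclideanSpace.proj 1), ?_, EuclideanSpace.single 0 1, ?_, ?_⟩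
    · simp [Fin.sum_univ_two]
    · simp
    · simp
  · refine ⟨Complex.ofRealCLM.comp (EuclideanSpace.proj 0)
      + Complex.I • Complex.ofRealCLM.comp (EuclideanSpace.proj 1), ?_, EuclideanSpace.single 0 1, ?_, ?_⟩
    · simp [Fin.sum_univ_three]
    · simp
    · simp

open scoped Pointwise in
lemma ballL2_loc {N : ℕ} {f : ℝ → ℝ} {δ τ : ℝ} (hf : Continuous f) (m : ℕ) (hm : m ≠ 0)
    (ℓ : EuclideanSpace ℝ (Fin N) →L[ℝ] ℂ) (hτ : τ ∈ Ioo (0:ℝ) 1)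
    (hpos : ∀ r ∈ Icc (0:ℝ) 1, 0 < f r) (hmono : MonotoneOn (fun r => r ^ δ * f r) (Icc 0 1)) :
    ballL2 N (fun y => f ‖y‖ • ℓ y ^ m) τ ≤ τ ^ ((m:ℝ) - δ) * ballL2 N (fun y => f ‖y‖ • ℓ y ^ m) 1 := by
  set v : EuclideanSpace ℝ (Fin N) → ℂ := fun y => f ‖y‖ • ℓ y ^ m with hv
  have cv : Continuous v := by rw [hv]; fun_prop
  have hτ0 := hτ.1
  have hT : 0 < τ ^ ((m:ℝ) - δ) := Real.rpow_pos_of_pos hτ0 _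
  have hpt : ∀ x ∈ ball (0 : EuclideanSpace ℝ (Fin N)) 1,
      ‖v (τ • x)‖ ^ 2 ≤ (τ ^ ((m:ℝ) - δ)) ^ 2 * ‖v x‖ ^ 2 := by
    intro x hx
    rw [mem_ball_zero_iff] at hx
    rw [← mul_pow]
    gcongr
    by_cases hx0 : x = 0
    · simp [hx0, hv, hm]
    have hx1 : 0 < ‖x‖ := norm_pos_iff.mpr hx0
    have hτx : τ * ‖x‖ ≤ ‖x‖ := mul_le_of_le_one_left hx1.le hτ.2.le
    have h1 := hmono (a := τ * ‖x‖) (b := ‖x‖) ⟨by positivity, hτx.trans hx.le⟩ ⟨hx1.le, hx.le⟩ hτx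
    simp only at h1
    rw [Real.mul_rpow hτ0.le hx1.le] at h1
    have h2 : τ ^ δ * f (τ * ‖x‖) ≤ f ‖x‖ := by
      have : 0 < ‖x‖ ^ δ := Real.rpow_pos_of_pos hx1 _
      refine le_of_mul_le_mul_left ?_ this
      linarith
    have p1 := hpos (τ * ‖x‖) ⟨by positivity, hτx.trans hx.le⟩
    have p2 := hpos ‖x‖ ⟨hx1.le, hx.le⟩
    simp only [hv]
    rw [norm_smul, norm_smul, norm_smul, map_smul, norm_pow, norm_smul, Real.norm_of_nonneg hτ0.le,
      Real.norm_of_nonneg p1.le, Real.norm_of_nonneg p2.le, mul_pow, norm_pow]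
    have h3 : τ ^ m = τ ^ ((m:ℝ) - δ) * τ ^ δ := by
      rw [← Real.rpow_add hτ0, sub_add_cancel, Real.rpow_natCast]
    rw [h3]
    calc f (τ * ‖x‖) * (τ ^ ((m:ℝ) - δ) * τ ^ δ * ‖ℓ x‖ ^ m)
        = τ ^ ((m:ℝ) - δ) * (τ ^ δ * f (τ * ‖x‖)) * ‖ℓ x‖ ^ m := by ring
      _ ≤ τ ^ ((m:ℝ) - δ) * f ‖x‖ * ‖ℓ x‖ ^ m := by gcongr
      _ = _ := by ring
  have hInt : ∀ w : EuclideanSpace ℝ (Fin N) → ℝ, Continuous w →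
      IntegrableOn w (ball (0 : EuclideanSpace ℝ (Fin N)) 1) := fun w hw =>
    (hw.continuousOn.integrableOn_compact (isCompact_closedBall 0 1)).mono_set ball_subset_closedBall
  have hle : ∫ x in ball (0 : EuclideanSpace ℝ (Fin N)) 1, ‖v (τ • x)‖ ^ 2 ≤
      (τ ^ ((m:ℝ) - δ)) ^ 2 * ∫ x in ball (0 : EuclideanSpace ℝ (Fin N)) 1, ‖v x‖ ^ 2 := by
    rw [← integral_const_mul]
    exact setIntegral_mono_on (hInt _ (by fun_prop)) (hInt _ (by fun_prop)) measurableSet_ball hpt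
  have hsub := Measure.setIntegral_comp_smul_of_pos volume (fun x : EuclideanSpace ℝ (Fin N) => ‖v x‖ ^ 2)
    (ball (0 : EuclideanSpace ℝ (Fin N)) 1) hτ0
  have hball : τ • ball (0 : EuclideanSpace ℝ (Fin N)) 1 = ball 0 τ := by
    rw [_root_.smul_ball hτ0.ne']
    simp [abs_of_pos hτ0]
  rw [hball, smul_eq_mul] at hsub
  have hge : ∫ x in ball (0 : EuclideanSpace ℝ (Fin N)) τ, ‖v x‖ ^ 2 ≤
      ∫ x in ball (0 : EuclideanSpace ℝ (Fin N)) 1, ‖v (τ • x)‖ ^ 2 := by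
    rw [hsub]
    apply le_mul_of_one_le_left (by positivity)
    apply (one_le_inv₀ (by positivity)).mpr
    exact pow_le_one₀ hτ0.le hτ.2.le
  unfold ballL2
  rw [← Real.sqrt_sq hT.le, ← Real.sqrt_mul (by positivity)]
  exact Real.sqrt_le_sqrt (hge.trans hle)


lemma divSigmaGrad_congr {N : ℕ} {σ σ' : ℝ → ℝ} (he : ∀ r ∈ Icc (0:ℝ) 1, σ' r = σ r)
    (u : EuclideanSpace ℝ (Fin N) → ℂ) (x : EuclideanSpace ℝ (Fin N))
    (hx : x ∈ ball (0 : EuclideanSpace ℝ (Fin N)) 1) :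
    divSigmaGrad N σ u x = divSigmaGrad N σ' u x := by
  unfold divSigmaGrad
  refine Finset.sum_congr rfl fun i _ => ?_
  congr 1
  apply Filter.EventuallyEq.fderiv_eq
  filter_upwards [isOpen_ball.mem_nhds hx] with y hy
  rw [he ‖y‖ ⟨norm_nonneg _, (mem_ball_zero_iff.mp hy).le⟩]

lemma eigenpair {N : ℕ} {σ n σ' dσ n' : ℝ → ℝ} (h : RadCoef σ' dσ n')
    (eσ : ∀ r ∈ Icc (0:ℝ) 1, σ' r = σ r) (en : ∀ r ∈ Icc (0:ℝ) 1, n' r = n r)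
    (ℓ : EuclideanSpace ℝ (Fin N) →L[ℝ] ℂ) (hℓ : ∑ i, ℓ (EuclideanSpace.single i 1) ^ 2 = 0)
    (j p : ℕ) (hp : p + 2 = 2 * (j + 5) + N) {k K : ℝ} (hk : k ∈ Icc 0 K) {g G f f' : ℝ × ℝ → ℝ}
    (hg : RadSol σ' dσ n' (j + 5) p K g G)
    (hf : RadSol (fun _ => 1) (fun _ => 0) (fun _ => 1) (j + 5) p K f f') (hg1 : g (1, k) ≠ 0)
    (hD : g (1, k) * (f' (1, k) + (j + 5 : ℕ) * f (1, k))
      = σ' 1 * (G (1, k) + (j + 5 : ℕ) * g (1, k)) * f (1, k))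
    (hv : ¬ EqOn (fun y => f (‖y‖, k) • ℓ y ^ (j + 5)) 0 (closedBall (0 : EuclideanSpace ℝ (Fin N)) 1)) :
    IsTransmissionEigenpair N k σ n
      (fun y => (f (1, k) / g (1, k) * g (‖y‖, k)) • ℓ y ^ (j + 5))
      (fun y => f (‖y‖, k) • ℓ y ^ (j + 5)) := by
  set c := f (1, k) / g (1, k) with hc
  have cg := hg.cg
  have cG := hg.cG
  have cf := slice_cont hf.cg k
  have cf' := slice_cont hf.cG k
  have cT := hg.cT h k
  have cS := hf.cT radCoef_one k
  have cg2 : Continuous fun r => c * g (r, k) := by fun_prop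
  have cG2 : Continuous fun r => c * G (r, k) := by fun_prop
  have cT2 : Continuous fun r => c * radT σ' dσ n' (j + 5) p k g G r := by fun_prop
  have dg2 : ∀ r, HasDerivAt (fun r => c * g (r, k)) (c * G (r, k)) r := fun r =>
    (hg.dg r k).const_mul c
  have dG2 : ∀ r ∈ Ioo (0:ℝ) 1, HasDerivAt (fun r => c * G (r, k))
      (c * radT σ' dσ n' (j + 5) p k g G r / r) r := fun r hr =>
    ((hg.dG2 h hk hr).const_mul c).congr_deriv (by ring)
  have dS : ∀ r ∈ Ioo (0:ℝ) 1, HasDerivAt (fun r => f' (r, k)) _ r := fun r hr =>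
    hf.dG2 radCoef_one hk hr
  have df : ∀ r, HasDerivAt (fun r => f (r, k)) (f' (r, k)) r := fun r => hf.dg r k
  have su := rad_smooth cg2 cG2 dg2 cT2 dG2 ℓ j
  have sv := rad_smooth cf cf' df cS dS ℓ j
  refine ⟨su.1, su.2, sv.1, sv.2, ?_, ?_, ?_, ?_, fun hh => hv hh.2⟩
  · intro x hx
    rw [divSigmaGrad_congr eσ _ x hx, ← en ‖x‖ ⟨norm_nonneg _, (mem_ball_zero_iff.mp hx).le⟩]
    exact rad_pde (p := p) h.cσ h.cdσ h.pos h.der cg2 cG2 dg2 cT2 dG2 ℓ j hp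
      (fun r => by simp only [radT]; ring) hℓ x hx
  · intro x hx
    have := rad_pde (σ := fun _ => 1) (dσ := fun _ => 0) (n := fun _ => 1) (k := k) (p := p)
      continuous_const continuous_const (fun _ => one_pos)
      (fun r _ => hasDerivAt_const r 1) cf cf' df cS dS ℓ j hp (fun r => by simp only [radT]) hℓ x hx
    simpa [divSigmaGrad, lap] using this
  · intro x hx
    simp only [hx]
    congr 1
    rw [hc]; field_simp
  · intro x hx
    rw [rad_normal cg2 cG2 dg2 ℓ j x hx, rad_normal cf cf' df ℓ j x hx, ← mul_assoc]
    congr 1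
    rw [← eσ 1 ⟨zero_le_one, le_rfl⟩]
    norm_cast
    rw [hc]
    field_simp
    linear_combination -hD

lemma main_aux {n σ : ℝ → ℝ} {n₁ n₂ M₁ M₂ : ℝ} (hA : AssumptionA n σ n₁ n₂ M₁ M₂) :
    ∃ σ' dσ n' : ℝ → ℝ, RadCoef σ' dσ n' ∧ (∀ r ∈ Icc (0:ℝ) 1, σ' r = σ r) ∧
      (∀ r ∈ Icc (0:ℝ) 1, n' r = n r) ∧ (∀ r ∈ Ioo (0:ℝ) 1, dσ r ≤ 0) ∧
      (∀ r ∈ Icc (0:ℝ) 1, 1 / M₂ ≤ σ' r ∧ σ' r ≤ n₂ ^ 2 ∧ M₁ * σ' r ≤ n' r ^ 2 ∧ n' r ^ 2 ≤ M₂ * σ' r) := by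
  obtain ⟨h1, h2, h3, h4, cn, cσ, hr⟩ := hA
  have hσ : ∀ r ∈ Icc (0:ℝ) 1, 0 < σ r := by
    intro r hr'
    obtain ⟨a1, a2, a3, a4, a5, -⟩ := hr r hr'
    by_contra hneg
    push Not at hneg
    have := div_nonpos_of_nonneg_of_nonpos (sq_nonneg (n r)) hneg
    linarith
  have h01 : (0:ℝ) ≤ 1 := zero_le_one
  have hcd : ContinuousOn (derivWithin σ (Icc 0 1)) (Icc 0 1) :=
    cσ.continuousOn_derivWithin (uniqueDiffOn_Icc one_pos) (by norm_num)
  refine ⟨IccExtend h01 ((Icc (0:ℝ) 1).domRestrict σ),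
    IccExtend h01 ((Icc (0:ℝ) 1).domRestrict (derivWithin σ (Icc 0 1))),
    IccExtend h01 ((Icc (0:ℝ) 1).domRestrict n), ⟨?_, ?_, ?_, ?_, ?_⟩, ?_, ?_, ?_, ?_⟩
  · exact cσ.continuousOn.domRestrict.Icc_extend'
  · exact hcd.domRestrict.Icc_extend'
  · exact cn.domRestrict.Icc_extend'
  · intro r
    exact hσ _ (projIcc 0 1 h01 r).2
  · intro r hr'
    have hr2 : r ∈ Icc (0:ℝ) 1 := ⟨hr'.1.le, hr'.2.le⟩
    rw [IccExtend_of_mem _ _ hr2]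
    have hd : HasDerivAt σ (derivWithin σ (Icc 0 1) r) r :=
      ((cσ.differentiableOn (by norm_num)) r hr2).hasDerivWithinAt.hasDerivAt (Icc_mem_nhds hr'.1 hr'.2)
    refine hd.congr_of_eventuallyEq ?_
    filter_upwards [Icc_mem_nhds hr'.1 hr'.2] with s hs
    rw [IccExtend_of_mem _ _ hs]
    rfl
  · intro r hr'; rw [IccExtend_of_mem _ _ hr']; rfl
  · intro r hr'; rw [IccExtend_of_mem _ _ hr']; rfl
  · intro r hr'
    have hr2 : r ∈ Icc (0:ℝ) 1 := ⟨hr'.1.le, hr'.2.le⟩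
    rw [IccExtend_of_mem _ _ hr2]
    exact (hr r hr2).2.2.1
  · intro r hr'
    rw [IccExtend_of_mem _ _ hr', IccExtend_of_mem _ _ hr']
    obtain ⟨a1, a2, a3, a4, a5, -⟩ := hr r hr'
    have hs := hσ r hr'
    change 1 / M₂ ≤ σ r ∧ σ r ≤ n₂ ^ 2 ∧ M₁ * σ r ≤ n r ^ 2 ∧ n r ^ 2 ≤ M₂ * σ r
    rw [le_div_iff₀ hs] at a4
    rw [div_le_iff₀ hs] at a5
    have hM2 : 0 < M₂ := by linarith
    have b1 : 1 ≤ n r ^ 2 := by nlinarith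
    have b2 : n r ^ 2 ≤ n₂ ^ 2 := by nlinarith
    refine ⟨?_, ?_, a4, a5⟩
    · rw [div_le_iff₀ hM2]; linarith
    · nlinarith


/-- Boundary localization of the `v`-parts of transmission eigenfunctions in a
spherically stratified medium satisfying Assumption A. -/
theorem boundary_localization_radial
    (N : ℕ) (hN : N = 2 ∨ N = 3) (n σ : ℝ → ℝ) (n₁ n₂ M₁ M₂ : ℝ)
    (hA : AssumptionA n σ n₁ n₂ M₁ M₂) (τ : ℝ) (hτ : τ ∈ Ioo (0:ℝ) 1) :
    ∃ (k : ℕ → ℝ) (u v : ℕ → EuclideanSpace ℝ (Fin N) → ℂ),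
      (∀ m, 0 < k m) ∧
      Tendsto k atTop atTop ∧
      (∀ m, IsTransmissionEigenpair N (k m) σ n (u m) (v m)) ∧
      (∀ m, ¬ EqOn (v m) 0 (closedBall (0 : EuclideanSpace ℝ (Fin N)) 1)) ∧
      Tendsto (fun m => ballL2 N (v m) τ / ballL2 N (v m) 1) atTop (nhds 0) := by
  obtain ⟨σ', dσ, n', hc, eσ, en, hdσ, hb⟩ := main_aux hA
  obtain ⟨h1, h2, hM₁, hM₂, -, -, -⟩ := hA
  obtain ⟨ℓ, hℓ, x₀, hx₀, hℓx₀⟩ := exists_ell hN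
  have hM1 : 0 < M₁ := by linarith
  have hM2 : 0 < M₂ := by linarith
  -- the parameters
  obtain ⟨α, hα, hα2⟩ : ∃ α : ℝ, 0 < α ∧ α ^ 2 * M₂ = 1 :=
    ⟨√(1 / M₂), by positivity, by rw [Real.sq_sqrt (by positivity)]; field_simp⟩
  obtain ⟨b, hb0, hbM⟩ : ∃ b : ℝ, 0 < b ∧ b ^ 2 * M₁ = (M₁ + 1) / 2 :=
    ⟨√((M₁ + 1) / (2 * M₁)), by positivity, by rw [Real.sq_sqrt (by positivity)]; field_simp⟩
  have hb1 : b < 1 := by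
    by_contra hcon
    push Not at hcon
    nlinarith [mul_le_mul_of_nonneg_right (show (1:ℝ) ≤ b ^ 2 by nlinarith) hM1.le]
  have hαM : α ^ 2 * M₁ < 1 := by
    rw [← hα2]; gcongr
  have hαb : α < b := by
    by_contra hcon
    push Not at hcon
    have : b ^ 2 * M₁ ≤ α ^ 2 * M₁ := by gcongr
    linarith
  obtain ⟨η, hη0, hη2⟩ : ∃ η : ℝ, 0 < η ∧ η ^ 2 = 1 - b ^ 2 := by
    have : 0 < 1 - b ^ 2 := by nlinarith
    exact ⟨√(1 - b ^ 2), Real.sqrt_pos.mpr this, Real.sq_sqrt this.le⟩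
  have hη1 : η < 1 := by nlinarith
  obtain ⟨ρ, hρ0, hρ1, hρ2⟩ : ∃ ρ : ℝ, 0 < ρ ∧ ρ < 1 ∧ ρ ^ 2 * ((M₁ + 1) / 2) = (M₁ + 3) / 4 := by
    refine ⟨√((M₁ + 3) / (2 * (M₁ + 1))), by positivity, ?_, ?_⟩
    · rw [Real.sqrt_lt' one_pos, div_lt_iff₀ (by positivity)]; linarith
    · rw [Real.sq_sqrt (by positivity)]; field_simp; norm_num
  obtain ⟨e, he, he2⟩ : ∃ e : ℝ, 0 < e ∧ 1 + 2 * e = (M₁ + 3) / 4 :=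
    ⟨(M₁ - 1) / 8, by linarith, by ring⟩
  obtain ⟨r₁, hr₁α, hr₁1, hr₁ρ⟩ : ∃ r₁ : ℝ, α ≤ r₁ ∧ r₁ < 1 ∧ ρ ≤ r₁ :=
    ⟨max α ρ, le_max_left _ _, max_lt (hαb.trans hb1) hρ1, le_max_right _ _⟩
  have hr₁0 : 0 < r₁ := hα.trans_le hr₁α
  have hr₁e : 1 + 2 * e ≤ b ^ 2 * r₁ ^ 2 * M₁ := by
    calc 1 + 2 * e = ρ ^ 2 * ((M₁ + 1) / 2) := by rw [he2, hρ2]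
      _ ≤ r₁ ^ 2 * ((M₁ + 1) / 2) := by gcongr
      _ = _ := by rw [← hbM]; ring
  have hn₂ : 0 < n₂ := by linarith
  obtain ⟨c, hc0, hc1, hc2⟩ : ∃ c : ℝ, 0 < c ∧ c ≤ 1 / n₂ ^ 2 ∧ c ≤ e * r₁ ^ 2 * (1 / M₂) :=
    ⟨min (1 / n₂ ^ 2) (e * r₁ ^ 2 * (1 / M₂)), lt_min (by positivity) (by positivity),
      min_le_left _ _, min_le_right _ _⟩
  obtain ⟨j₀, hj₀⟩ := exists_nat_ge (max (1 / e) (2 * Real.pi / (c * (1 - r₁))))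
  have hj1 : 1 / e ≤ j₀ := (le_max_left _ _).trans hj₀
  have hj2 : 2 * Real.pi / (c * (1 - r₁)) ≤ j₀ := (le_max_right _ _).trans hj₀
  have h1r : 0 < 1 - r₁ := by linarith
  have key : ∀ i : ℕ, ∃ (k : ℝ) (u v : EuclideanSpace ℝ (Fin N) → ℂ), α * i ≤ k ∧ 0 < k ∧
      IsTransmissionEigenpair N k σ n u v ∧
      (¬ EqOn v 0 (closedBall (0 : EuclideanSpace ℝ (Fin N)) 1)) ∧
      ballL2 N v τ ≤ (τ ^ η) ^ i * ballL2 N v 1 := by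
    intro i
    set j := j₀ + i with hj
    have hmj : (j₀ : ℝ) ≤ ((j + 5 : ℕ) : ℝ) := by norm_cast; omega
    have hmi : (i : ℝ) ≤ ((j + 5 : ℕ) : ℝ) := by norm_cast; omega
    have hp : 2 * (j + 5) + N - 2 + 2 = 2 * (j + 5) + N := by omega
    obtain ⟨k, K, g, G, f, f', hk, hk1, hg, hf, hg1, hfpos, hmono, hD⟩ :=
      eigen_step (ω := c * ((j + 5 : ℕ) : ℝ)) hc hdσ (by positivity : 0 < 1 / M₂) hb hM1 hα hα2 hb0 hb1 hαb.le
        ⟨hη0, hη1⟩ hη2 ⟨hr₁α, hr₁1⟩ he hr₁e hN (j + 5) _ hp (by omega)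
        (by
          have := hj1.trans hmj
          rw [div_le_iff₀ he] at this
          linarith)
        (by
          calc c * ((j + 5 : ℕ) : ℝ) ≤ 1 / n₂ ^ 2 * ((j + 5 : ℕ) : ℝ) := by gcongr
            _ = _ := by ring)
        (by gcongr)
        (by
          have := hj2.trans hmj
          rw [div_le_iff₀ (by positivity)] at this
          linarith)
    have hv : ¬ EqOn (fun y => f (‖y‖, k) • ℓ y ^ (j + 5)) 0 (closedBall (0 : EuclideanSpace ℝ (Fin N)) 1) := by
      intro hcon
      have h0 := hcon (x := x₀) (by simp [hx₀])
      have h1 := (hfpos 1 ⟨zero_le_one, le_rfl⟩).ne'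
      simp [hx₀, hℓx₀, h1] at h0
    have hloc := ballL2_loc (N := N) (slice_cont hf.cg k) (j + 5) (by omega) ℓ hτ hfpos hmono
    have hαk : α * i ≤ k := le_trans (by gcongr) hk1
    refine ⟨k, _, _, hαk, lt_of_lt_of_le (by positivity) hk1,
      eigenpair hc eσ en ℓ hℓ j _ hp hk hg hf hg1 hD hv, hv, hloc.trans ?_⟩
    have hL : 0 ≤ ballL2 N (fun y => f (‖y‖, k) • ℓ y ^ (j + 5)) 1 := Real.sqrt_nonneg _
    refine mul_le_mul_of_nonneg_right ?_ hL
    rw [← Real.rpow_natCast, ← Real.rpow_mul hτ.1.le]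
    apply Real.rpow_le_rpow_of_exponent_ge hτ.1 hτ.2.le
    have : η * i ≤ η * ((j + 5 : ℕ) : ℝ) := by gcongr
    linarith
  choose k u v hk hk0 hpair hne hle using key
  refine ⟨k, u, v, hk0, ?_, hpair, hne, ?_⟩
  · exact tendsto_atTop_mono hk (tendsto_natCast_atTop_atTop.const_mul_atTop hα)
  · have hτη0 : 0 ≤ τ ^ η := Real.rpow_nonneg hτ.1.le _
    have hτη : τ ^ η < 1 := Real.rpow_lt_one hτ.1.le hτ.2 hη0
    refine squeeze_zero (fun i => div_nonneg (Real.sqrt_nonneg _) (Real.sqrt_nonneg _)) (fun i => ?_)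
      (tendsto_pow_atTop_nhds_zero_of_lt_one hτη0 hτη)
    exact div_le_of_le_mul₀ (Real.sqrt_nonneg _) (by positivity) (hle i)

end
end

section
/- Let N ∈ {2,3} and let Ω be the open unit ball in ℝ^N. Let σ and n be positive constants with n² > σ. Then for every τ ∈ (0,1) there exist a sequence of positive numbers k_m with k_m → ∞ as m → ∞ and, for each m, a transmission eigenpair (u_m, v_m) for (k_m, σ, n) with neither u_m nor v_m identically zero, such that both ‖u_m‖_{L²(Ω_τ)} / ‖u_m‖_{L²(Ω)} → 0 and ‖v_m‖_{L²(Ω_τ)} / ‖v_m‖_{L²(Ω)} → 0 as m → ∞. -/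
open Metric MeasureTheory Filter Set

noncomputable section

/-! ### The normalised Bessel series -/

/-- Coefficients of the normalised Bessel series. -/
def bcoef (M j : ℕ) : ℝ :=
  (-1) ^ j / (2 ^ j * (j.factorial : ℝ) * ∏ i ∈ Finset.range j, ((M : ℝ) + 2 * i))

/-- Normalised Bessel series `∑ (-1)^j t^j / (2^j j! ∏_{i<j} (M + 2 * i))`. -/
def bess (M : ℕ) (t : ℝ) : ℝ := ∑' j, bcoef M j * t ^ j

lemma bprod_ge (M j : ℕ) (hM : 1 ≤ M) :
    1 ≤ ∏ i ∈ Finset.range j, ((M : ℝ) + 2 * i) := by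
  have hM' : (1:ℝ) ≤ M := by exact_mod_cast hM
  induction j with
  | zero => simp
  | succ j ih =>
    rw [Finset.prod_range_succ]
    have : (0:ℝ) ≤ j := Nat.cast_nonneg j
    nlinarith

lemma bcoef_abs (M j : ℕ) (hM : 1 ≤ M) : |bcoef M j| ≤ 1 / (j.factorial : ℝ) := by
  have h1 := bprod_ge M j hM
  have h2 : (1:ℝ) ≤ 2 ^ j := one_le_pow₀ (by norm_num)
  have h3 : (0:ℝ) < j.factorial := by positivity
  unfold bcoef
  rw [abs_div, abs_pow, abs_neg, abs_one, one_pow]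
  apply one_div_le_one_div_of_le h3
  rw [abs_of_pos (by positivity)]
  calc (j.factorial : ℝ) = 1 * j.factorial * 1 := by ring
    _ ≤ _ := by gcongr

lemma bcoef_succ_left (M j : ℕ) (hM : 1 ≤ M) :
    ((j:ℝ) + 1) * bcoef M (j + 1) = - bcoef (M + 2) j / (2 * M) := by
  have hM' : (0:ℝ) < M := by exact_mod_cast hM
  have h1 := bprod_ge (M+2) j (by omega)
  unfold bcoef
  rw [Finset.prod_range_succ', Nat.factorial_succ]
  have : ∏ k ∈ Finset.range j, ((M : ℝ) + 2 * ((k + 1 : ℕ) : ℝ))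
      = ∏ i ∈ Finset.range j, (((M + 2 : ℕ) : ℝ) + 2 * i) := by
    apply Finset.prod_congr rfl; intro k _; push_cast; ring
  rw [this]
  have h4 : (0:ℝ) < j.factorial := by positivity
  set p := ∏ i ∈ Finset.range j, (((M + 2 : ℕ) : ℝ) + 2 * i)
  have hp : p ≠ 0 := by positivity
  have : (j:ℝ) + 1 ≠ 0 := by positivity
  push_cast
  field_simp
  ring

lemma bcoef_succ_right (M j : ℕ) (hM : 1 ≤ M) :
    bcoef M (j + 1) * (2 * (j + 1) * (M + 2 * j)) = - bcoef M j := by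
  have hM' : (0:ℝ) < M := by exact_mod_cast hM
  have h1 := bprod_ge M j (by omega)
  unfold bcoef
  rw [Finset.prod_range_succ, Nat.factorial_succ]
  have h4 : (0:ℝ) < j.factorial := by positivity
  set p := ∏ i ∈ Finset.range j, ((M : ℝ) + 2 * i)
  have hp : p ≠ 0 := by positivity
  have : (j:ℝ) + 1 ≠ 0 := by positivity
  have : (M:ℝ) + 2 * j ≠ 0 := by positivity
  push_cast
  field_simp
  ring

lemma bess_summable (M : ℕ) (hM : 1 ≤ M) (t : ℝ) : Summable fun j => bcoef M j * t ^ j := by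
  refine Summable.of_norm_bounded (Real.summable_pow_div_factorial |t|) ?_
  intro j
  rw [norm_mul, Real.norm_eq_abs, norm_pow, Real.norm_eq_abs]
  calc _ ≤ 1 / (j.factorial : ℝ) * |t| ^ j := by gcongr; exact bcoef_abs M j hM
    _ = _ := by ring

lemma bess_zero (M : ℕ) : bess M 0 = 1 := by
  unfold bess
  rw [tsum_eq_single 0]
  · simp [bcoef]
  · intro j hj; simp [hj]

lemma bess_hasDerivAt (M : ℕ) (hM : 1 ≤ M) (t : ℝ) :
    HasDerivAt (bess M) (- bess (M + 2) t / (2 * M)) t := by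
  have hM' : (1:ℝ) ≤ M := by exact_mod_cast hM
  set r := |t| + 1
  have hr : 0 ≤ r := by positivity
  have key : ∀ (j : ℕ) (y : ℝ), bcoef M (j+1) * (((j+1 : ℕ):ℝ) * y ^ j)
      = - (bcoef (M+2) j * y ^ j) / (2 * M) := by
    intro j y
    have := bcoef_succ_left M j hM
    push_cast
    calc _ = (((j:ℝ) + 1) * bcoef M (j + 1)) * y ^ j := by ring
      _ = _ := by rw [this]; ring
  have h := hasDerivAt_tsum_of_isPreconnected (𝕜 := ℝ)
    (g := fun j y => bcoef M j * y ^ j) (g' := fun j y => bcoef M j * ((j:ℝ) * y ^ (j-1)))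
    (u := fun j => r ^ (j-1) / ((j-1).factorial : ℝ))
    (t := Metric.ball (0:ℝ) r) (y₀ := 0) (y := t) ?_ Metric.isOpen_ball
    (convex_ball (0:ℝ) r).isPreconnected ?_ ?_ ?_ (bess_summable M hM 0) ?_
  · unfold bess
    refine h.congr_deriv ?_
    rw [Summable.tsum_eq_zero_add]
    · simp only [Nat.add_sub_cancel, key]
      simp only [Nat.cast_zero, zero_mul, mul_zero, zero_add]
      rw [tsum_div_const, tsum_neg]
    · rw [← summable_nat_add_iff 1]
      simp only [Nat.add_sub_cancel, key]
      exact ((bess_summable (M+2) (by omega) t).neg).div_const _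
  · rw [← summable_nat_add_iff 1]
    exact Real.summable_pow_div_factorial r
  · intro j y _
    exact (hasDerivAt_pow j y).const_mul _
  · intro j y hy
    rcases j with _ | j
    · simp
    · simp only [Nat.add_sub_cancel, key]
      have hy' : |y| ≤ r := by simpa using (mem_ball_zero_iff.1 hy).le
      have hb := bcoef_abs (M+2) j (by omega)
      rw [norm_div, norm_neg, norm_mul, norm_pow, Real.norm_eq_abs, Real.norm_eq_abs,
        Real.norm_eq_abs, abs_of_nonneg (by positivity : (0:ℝ) ≤ 2 * M)]
      rw [div_le_iff₀ (by positivity)]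
      calc |bcoef (M+2) j| * |y| ^ j ≤ (1 / (j.factorial : ℝ)) * r ^ j := by gcongr
        _ = r ^ j / (j.factorial : ℝ) * 1 := by ring
        _ ≤ _ := by gcongr; linarith
  · simp; positivity
  · simp [r]

lemma bess_contig (M : ℕ) (hM : 1 ≤ M) (t : ℝ) :
    t * bess (M + 4) t = (M * (M + 2)) * (bess (M + 2) t - bess M t) := by
  have hM' : (1:ℝ) ≤ M := by exact_mod_cast hM
  have e1 : t * bess (M+4) t = ∑' j, bcoef (M+4) j * t ^ (j+1) := by
    unfold bess; rw [← tsum_mul_left]; congr 1; ext j; ring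
  have e2 : bess (M+2) t - bess M t = ∑' j, (bcoef (M+2) (j+1) - bcoef M (j+1)) * t ^ (j+1) := by
    unfold bess
    rw [← (bess_summable (M+2) (by omega) t).tsum_sub (bess_summable M hM t),
      Summable.tsum_eq_zero_add ((bess_summable (M+2) (by omega) t).sub (bess_summable M hM t))]
    simp only [bcoef]
    simp [sub_mul]
  rw [e1, e2, ← tsum_mul_left]
  congr 1; ext j
  rw [← mul_assoc]
  congr 1
  have a1 := bcoef_succ_left (M+2) j (by omega)
  have a2 := bcoef_succ_left M j hM
  have a3 := bcoef_succ_right (M+2) j (by omega)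
  push_cast at a1 a3
  have hj : (0:ℝ) < (j:ℝ) + 1 := by positivity
  have hp : (M:ℝ) + 2 ≠ 0 := by positivity
  have hp' : (M:ℝ) ≠ 0 := by positivity
  rw [eq_div_iff (by positivity)] at a1 a2
  have b1 : bcoef (M+2+2) j = - (((j:ℝ)+1) * bcoef (M+2) (j+1) * (2 * (M+2))) := by linarith
  have b2 : ((j:ℝ)+1) * (bcoef M (j+1) * M) = ((j:ℝ)+1) * (bcoef (M+2) (j+1) * (M + 2 + 2*j)) := by
    linarith
  have b3 := mul_left_cancel₀ hj.ne' b2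
  show bcoef (M+2+2) j = _
  rw [b1, mul_sub]
  linear_combination ((M:ℝ)+2) * b3

lemma bess_contDiff (n : ℕ) : ∀ M : ℕ, 1 ≤ M → ContDiff ℝ n (bess M) := by
  induction n with
  | zero =>
    intro M hM
    exact contDiff_zero.2 (continuous_iff_continuousAt.2
      fun t => (bess_hasDerivAt M hM t).continuousAt)
  | succ n ih =>
    intro M hM
    have hd : deriv (bess M) = fun t => - bess (M + 2) t / (2 * M) :=
      funext fun t => (bess_hasDerivAt M hM t).deriv
    push_cast
    rw [contDiff_succ_iff_deriv]
    refine ⟨fun t => (bess_hasDerivAt M hM t).differentiableAt, by simp, ?_⟩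
    rw [hd]
    exact ((ih (M+2) (by omega)).neg).div_const _

/-- `y(s) = bess M (s^2)`. -/
def by0 (M : ℕ) (s : ℝ) : ℝ := bess M (s ^ 2)
/-- The derivative of `by0`. -/
def by1 (M : ℕ) (s : ℝ) : ℝ := - s * bess (M + 2) (s ^ 2) / M

lemma by0_zero (M : ℕ) : by0 M 0 = 1 := by simp [by0, bess_zero]

lemma by0_deriv (M : ℕ) (hM : 1 ≤ M) (s : ℝ) : HasDerivAt (by0 M) (by1 M s) s := by
  have h := (bess_hasDerivAt M hM (s^2)).comp s (hasDerivAt_pow 2 s)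
  refine h.congr_deriv ?_
  have hM' : (0:ℝ) < M := by exact_mod_cast hM
  unfold by1
  push_cast
  field_simp

lemma by1_deriv (M : ℕ) (hM : 1 ≤ M) (s : ℝ) (hs : s ≠ 0) :
    HasDerivAt (by1 M) (-((M:ℝ) - 1) / s * by1 M s - by0 M s) s := by
  have h := (((hasDerivAt_id s).neg).mul
    ((bess_hasDerivAt (M+2) (by omega) (s^2)).comp s (hasDerivAt_pow 2 s))).div_const (M:ℝ)
  refine h.congr_deriv ?_
  have hM' : (0:ℝ) < M := by exact_mod_cast hM
  have hp : (M:ℝ) + 2 ≠ 0 := by positivity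
  have c := bess_contig M hM (s^2)
  unfold by1 by0
  simp only [Function.comp, Pi.neg_apply, id]
  push_cast
  have c' : bess (M+2+2) (s^2) * s^2 = (M * (M + 2)) * (bess (M + 2) (s^2) - bess M (s^2)) := by
    rw [← c]; ring
  field_simp
  linear_combination (1:ℝ) * c'

lemma by0_cont (M : ℕ) (hM : 1 ≤ M) : Continuous (by0 M) :=
  continuous_iff_continuousAt.2 fun t => (by0_deriv M hM t).continuousAt

lemma by1_cont (M : ℕ) : Continuous (by1 M) := by
  have : Continuous (bess (M+2)) := (bess_contDiff 0 (M+2) (by omega)).continuous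
  unfold by1
  fun_prop

/-! ### ODE lemmas -/

lemma le_of_hasDerivAt_nonneg (f f' : ℝ → ℝ) (a b : ℝ) (hab : a ≤ b)
    (hc : ContinuousOn f (Icc a b)) (hd : ∀ x ∈ Ioo a b, HasDerivAt f (f' x) x)
    (hp : ∀ x ∈ Ioo a b, 0 ≤ f' x) : f a ≤ f b := by
  refine monotoneOn_of_deriv_nonneg (convex_Icc a b) hc ?_ ?_ (left_mem_Icc.2 hab)
    (right_mem_Icc.2 hab) hab
  · rw [interior_Icc]
    exact fun x hx => (hd x hx).differentiableAt.differentiableWithinAt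
  · rw [interior_Icc]
    intro x hx
    rw [(hd x hx).deriv]; exact hp x hx

/-- The energy `y² + y'²` is positive. -/
lemma energy_pos (M : ℕ) (hM : 2 ≤ M) (s : ℝ) (hs : 0 < s) :
    by0 M s ≠ 0 ∨ by1 M s ≠ 0 := by
  by_contra! hcon
  obtain ⟨h0, h1⟩ := hcon
  have hM' : (2:ℝ) ≤ M := by exact_mod_cast hM
  -- a small point where y is nonzero
  obtain ⟨a, ha0, has, hya⟩ : ∃ a, 0 < a ∧ a < s ∧ by0 M a ≠ 0 := by
    have hc : ∀ᶠ x in nhds (0:ℝ), by0 M x ≠ 0 :=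
      (by0_cont M (by omega)).continuousAt.eventually_ne (by rw [by0_zero]; norm_num)
    have h2 : ∀ᶠ x in nhdsWithin (0:ℝ) (Ioi 0), x ∈ Ioo (0:ℝ) s := Ioo_mem_nhdsGT hs
    obtain ⟨a, h3, h4⟩ := ((hc.filter_mono nhdsWithin_le_nhds).and h2).exists
    exact ⟨a, h4.1, h4.2, h3⟩
  have key := le_of_hasDerivAt_nonneg
    (fun x => x ^ (2 * M) * (by0 M x ^ 2 + by1 M x ^ 2))
    (fun x => ((2 * M : ℕ):ℝ) * x ^ (2 * M - 1) * (by0 M x ^ 2 + by1 M x ^ 2)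
      + x ^ (2 * M) * (2 * by0 M x * by1 M x
        + 2 * by1 M x * (-((M:ℝ) - 1) / x * by1 M x - by0 M x)))
    a s has.le ?_ ?_ ?_
  · simp only [h0, h1] at key
    have : 0 < a ^ (2 * M) * (by0 M a ^ 2 + by1 M a ^ 2) := by positivity
    norm_num at key
    linarith
  · have := by0_cont M (by omega)
    have := by1_cont M
    fun_prop
  · intro x hx
    have hx0 : x ≠ 0 := (ha0.trans hx.1).ne'
    have := (hasDerivAt_pow (2*M) x).mul
      (((by0_deriv M (by omega) x).pow 2).add ((by1_deriv M (by omega) x hx0).pow 2))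
    refine this.congr_deriv ?_
    simp
  · intro x hx
    have hx0 : 0 < x := ha0.trans hx.1
    have e : x ^ (2*M) = x ^ (2*M-1) * x := by rw [← pow_succ]; congr 1; omega
    rw [e]
    have e2 : ((2 * M : ℕ):ℝ) * x ^ (2 * M - 1) * (by0 M x ^ 2 + by1 M x ^ 2)
      + x ^ (2 * M - 1) * x * (2 * by0 M x * by1 M x
        + 2 * by1 M x * (-((M:ℝ) - 1) / x * by1 M x - by0 M x))
      = x ^ (2 * M - 1) * (2 * M * by0 M x ^ 2 + 2 * by1 M x ^ 2) := by
      push_cast; field_simp; ring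
    rw [e2]; positivity

/-- Monotonicity of `s^α y` while `y ≥ 0`. -/
lemma pow_mul_mono_aux (M α b : ℕ) (hα : 1 ≤ α) (hb : 1 ≤ b) (hM : α + b + 2 = M) (T : ℝ)
    (hT : T ^ 2 ≤ α * b) (hpos : ∀ x ∈ Icc 0 T, 0 ≤ by0 M x) (s t : ℝ) (hs : 0 ≤ s)
    (hst : s ≤ t) (htT : t ≤ T) : s ^ α * by0 M s ≤ t ^ α * by0 M t := by
  have c0 := by0_cont M (by omega)
  have c1 := by1_cont M
  have hM' : (M:ℝ) = α + b + 2 := by rw [← hM]; push_cast; ring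
  have hP : ∀ x, 0 < x → x ≤ T → 0 ≤ α * by0 M x + x * by1 M x := by
    intro x hx hxT
    have key := le_of_hasDerivAt_nonneg
      (fun x => x ^ b * (α * by0 M x + x * by1 M x))
      (fun x => x ^ (b - 1) * (b * α - x ^ 2) * by0 M x) 0 x hx.le ?_ ?_ ?_
    · simp only [zero_pow (by omega : b ≠ 0), zero_mul] at key
      exact nonneg_of_mul_nonneg_right key (by positivity)
    · fun_prop
    · intro z hz
      have hz0 : z ≠ 0 := hz.1.ne'
      have := (hasDerivAt_pow b z).mul
        (((by0_deriv M (by omega) z).const_mul (α:ℝ)).add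
          ((hasDerivAt_id z).mul (by1_deriv M (by omega) z hz0)))
      refine this.congr_deriv ?_
      have e : z ^ b = z ^ (b-1) * z := by rw [← pow_succ]; congr 1; omega
      simp only [Pi.add_apply, Pi.mul_apply, id]
      rw [e, hM']
      field_simp
      ring
    · intro z hz
      have h1 := hpos z ⟨hz.1.le, by linarith [hz.2]⟩
      have h2 : z ^ 2 ≤ b * α := by
        have : z ^ 2 ≤ T ^ 2 := pow_le_pow_left₀ hz.1.le (by linarith [hz.2]) 2
        linarith
      have h3 : 0 ≤ z := hz.1.le
      have h4 : 0 ≤ (b:ℝ) * α - z ^ 2 := by linarith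
      positivity
  refine le_of_hasDerivAt_nonneg (fun x => x ^ α * by0 M x)
    (fun x => x ^ (α - 1) * (α * by0 M x + x * by1 M x)) s t hst (by fun_prop) ?_ ?_
  · intro z hz
    refine ((hasDerivAt_pow α z).mul (by0_deriv M (by omega) z)).congr_deriv ?_
    have e : z ^ α = z ^ (α-1) * z := by rw [← pow_succ]; congr 1; omega
    rw [e]; ring
  · intro z hz
    have hz0 : 0 < z := lt_of_le_of_lt hs hz.1
    exact mul_nonneg (by positivity) (hP z hz0 (by linarith [hz.2]))

lemma by0_pos (M α b : ℕ) (hα : 1 ≤ α) (hb : 1 ≤ b) (hM : α + b + 2 = M) (T : ℝ)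
    (hT0 : 0 ≤ T) (hT : T ^ 2 ≤ α * b) : 0 < by0 M T := by
  have c0 := by0_cont M (by omega)
  by_contra! hcon
  -- first zero
  have hcomp : IsCompact (Icc 0 T ∩ {x | by0 M x ≤ 0}) :=
    isCompact_Icc.inter_right (isClosed_le c0 continuous_const)
  obtain ⟨z, ⟨⟨hz0, hzT⟩, hz⟩, hmin⟩ := hcomp.exists_isLeast ⟨T, ⟨hT0, le_rfl⟩, hcon⟩
  have hz : by0 M z ≤ 0 := hz
  have hlt : ∀ x, 0 ≤ x → x < z → 0 < by0 M x := by
    intro x hx hxz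
    by_contra! h
    exact absurd (hmin ⟨⟨hx, by linarith⟩, h⟩) (not_le.2 hxz)
  have hzpos : 0 < z := by
    rcases hz0.eq_or_lt with h | h
    · rw [← h, by0_zero] at hz; linarith
    · exact h
  have hz2 : z ^ 2 ≤ α * b := le_trans (pow_le_pow_left₀ hz0 hzT 2) hT
  have hzz : 0 ≤ by0 M z := by
    by_contra! h
    obtain ⟨x, hx, hx'⟩ := intermediate_value_Icc' hzpos.le c0.continuousOn
      (show by0 M z / 2 ∈ Icc (by0 M z) (by0 M 0) by
        rw [by0_zero]; constructor <;> linarith)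
    have hxz : x < z := by
      rcases hx.2.eq_or_lt with h' | h'
      · rw [h'] at hx'; linarith
      · exact h'
    have := hlt x hx.1 hxz
    linarith
  have := pow_mul_mono_aux M α b hα hb hM z hz2 (fun x hx => by
    rcases hx.2.eq_or_lt with h' | h'
    · rw [h']; exact hzz
    · exact (hlt x hx.1 h').le) (z/2) z (by linarith) (by linarith) le_rfl
  have h1 := hlt (z/2) (by linarith) (by linarith)
  have h2 : 0 < (z/2)^α * by0 M (z/2) := by positivity
  have h3 : z ^ α * by0 M z ≤ 0 := mul_nonpos_of_nonneg_of_nonpos (by positivity) hz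
  linarith

lemma by0_growth (M α b : ℕ) (hα : 1 ≤ α) (hb : 1 ≤ b) (hM : α + b + 2 = M) (l s : ℝ)
    (hl : 1 ≤ l) (hs : 0 ≤ s) (hT : (l * s) ^ 2 ≤ α * b) :
    0 < by0 M s ∧ by0 M s ≤ l ^ α * by0 M (l * s) := by
  have hsl : s ≤ l * s := by nlinarith
  have pos : ∀ x ∈ Icc 0 (l*s), 0 < by0 M x := fun x hx =>
    by0_pos M α b hα hb hM x hx.1 ((pow_le_pow_left₀ hx.1 hx.2 2).trans hT)
  refine ⟨pos s ⟨hs, hsl⟩, ?_⟩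
  rcases hs.eq_or_lt with h | h
  · rw [← h, mul_zero, by0_zero, mul_one]; exact one_le_pow₀ hl
  · have := pow_mul_mono_aux M α b hα hb hM (l*s) hT (fun x hx => (pos x hx).le) s (l*s) hs hsl
      le_rfl
    rw [mul_pow] at this
    have hp : 0 < s ^ α := by positivity
    refine le_of_mul_le_mul_left ?_ hp
    linarith

/-- Sturm comparison. -/
lemma sturm_zero (M : ℕ) (hM : 3 ≤ M) (δ a : ℝ) (hδ : 0 < δ) (ha : 0 < a)
    (hQ : ((M:ℝ) - 1) * (M - 3) / 4 ≤ (1 - δ ^ 2) * a ^ 2) :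
    ∃ s ∈ Icc a (a + Real.pi / δ), by0 M s = 0 := by
  by_contra! hcon
  have c0 := by0_cont M (by omega)
  have c1 := by1_cont M
  have hpi : 0 < Real.pi / δ := div_pos Real.pi_pos hδ
  have hM' : (3:ℝ) ≤ M := by exact_mod_cast hM
  set e := a + Real.pi / δ with he
  have hae : a ≤ e := by linarith
  -- constant sign
  obtain ⟨ε, hε⟩ : ∃ ε : ℝ, ∀ s ∈ Icc a e, 0 < ε * by0 M s := by
    refine ⟨by0 M a, fun s hs => ?_⟩
    by_contra! h
    have ha' := hcon a ⟨le_rfl, hae⟩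
    have hc : ContinuousOn (fun s => by0 M a * by0 M s) (Icc a s) := by fun_prop
    obtain ⟨x, hx, hx'⟩ := intermediate_value_Icc' hs.1 hc
      (show (0:ℝ) ∈ Icc _ _ from ⟨h, mul_self_nonneg _⟩)
    have hx'' : by0 M x = 0 := by
      rcases mul_eq_zero.1 hx' with h | h
      · exact absurd h ha'
      · exact h
    exact hcon x ⟨hx.1, hx.2.trans hs.2⟩ hx''
  set p : ℝ := ((M:ℝ) - 1) / 2 with hp
  have hQ' : p * (p - 1) ≤ (1 - δ ^ 2) * a ^ 2 := by
    calc _ = ((M:ℝ) - 1) * (M - 3) / 4 := by rw [hp]; ring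
      _ ≤ _ := hQ
  have hpp : 0 ≤ p * (p - 1) := by
    have : 1 ≤ p := by rw [hp]; linarith
    nlinarith
  have hMp : (M:ℝ) - 1 = 2 * p := by rw [hp]; ring
  have key := le_of_hasDerivAt_nonneg
    (fun s => - (s ^ p * (ε * ((p / s * by0 M s + by1 M s) * Real.sin (δ * (s - a))
      - by0 M s * (δ * Real.cos (δ * (s - a)))))))
    (fun s => s ^ p * ((1 - δ ^ 2) - p * (p-1) / s ^ 2) * (ε * by0 M s) * Real.sin (δ * (s - a)))
    a e hae ?_ ?_ ?_
  · have e1 : δ * (e - a) = Real.pi := by rw [he]; field_simp; ring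
    simp only [e1, sub_self, mul_zero, Real.sin_zero, Real.cos_zero, Real.sin_pi, Real.cos_pi] at key
    have h1 := hε a ⟨le_rfl, hae⟩
    have h2 := hε e ⟨hae, le_rfl⟩
    have h3 : 0 < a ^ p := Real.rpow_pos_of_pos ha p
    have h4 : 0 < e ^ p := Real.rpow_pos_of_pos (by linarith) p
    have h5 : 0 < a ^ p * (δ * (ε * by0 M a)) := by positivity
    have h6 : 0 < e ^ p * (δ * (ε * by0 M e)) := by positivity
    nlinarith
  · intro x hx
    have hx0 : x ≠ 0 := by have := hx.1; intro h; linarith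
    apply ContinuousAt.continuousWithinAt
    have := Real.continuousAt_rpow_const x p (Or.inl hx0)
    have := c0.continuousAt (x := x)
    have := c1.continuousAt (x := x)
    fun_prop (disch := assumption)
  · intro x hx
    have hx0 : 0 < x := ha.trans hx.1
    have d0 := by0_deriv M (by omega) x
    have d1 := by1_deriv M (by omega) x hx0.ne'
    have dp := Real.hasDerivAt_rpow_const (x := x) (p := p) (Or.inl hx0.ne')
    have dl : HasDerivAt (fun s => δ * (s - a)) δ x := by
      simpa using ((hasDerivAt_id x).sub_const a).const_mul δ
    have ds := dl.sin
    have dc := (dl.cos).const_mul δ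
    have di : HasDerivAt (fun s : ℝ => p / s) (-p / x^2) x := by
      have := (hasDerivAt_inv hx0.ne').const_mul p
      simp only [← div_eq_mul_inv] at this
      refine this.congr_deriv ?_
      field_simp
    have := ((dp.mul (((((di.mul d0).add d1).mul ds).sub (d0.mul dc)).const_mul ε))).neg
    refine this.congr_deriv ?_
    simp only [Pi.add_apply, Pi.mul_apply, Pi.sub_apply]
    rw [Real.rpow_sub_one hx0.ne', hMp]
    field_simp
    ring
  · intro x hx
    have hx0 : 0 < x := ha.trans hx.1
    have h1 := hε x ⟨hx.1.le, hx.2.le⟩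
    have h2 : 0 ≤ Real.sin (δ * (x - a)) := by
      apply Real.sin_nonneg_of_nonneg_of_le_pi
      · have := hx.1; exact mul_nonneg hδ.le (by linarith)
      · have : x - a ≤ Real.pi / δ := by have := hx.2; linarith
        calc _ ≤ δ * (Real.pi / δ) := by gcongr
          _ = _ := by field_simp
    have h3 : 0 ≤ (1 - δ ^ 2) - p * (p-1) / x ^ 2 := by
      rw [sub_nonneg, div_le_iff₀ (by positivity)]
      have : a ^ 2 ≤ x ^ 2 := pow_le_pow_left₀ ha.le hx.1.le 2
      have h0 : 0 ≤ 1 - δ ^ 2 := by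
        by_contra! h
        have : 0 < a ^ 2 := by positivity
        nlinarith
      nlinarith
    have h4 : 0 ≤ x ^ p := Real.rpow_nonneg hx0.le p
    positivity

/-- Rolle argument producing the transmission eigenvalue. -/
lemma rolle_eig (M m : ℕ) (hM : 1 ≤ M) (hm : 1 ≤ m) (σ q s₁ s₂ : ℝ) (hσ : 0 < σ) (hq : 0 < q)
    (h1 : 0 < s₁) (h12 : s₁ < s₂) (hz1 : by0 M s₁ = 0) (hz2 : by0 M s₂ = 0)
    (hpos : ∀ x ∈ Icc s₁ s₂, 0 < by0 M (x / q)) :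
    ∃ κ ∈ Ioo s₁ s₂, σ * (m * by0 M κ + κ * by1 M κ) * by0 M (κ / q)
      = (m * by0 M (κ / q) + (κ / q) * by1 M (κ / q)) * by0 M κ := by
  have c0 := by0_cont M hM
  set R : ℝ → ℝ := fun s => s ^ m * by0 M s with hR
  have cR : Continuous R := by fun_prop
  have dR : ∀ s, HasDerivAt R (s ^ (m-1) * (m * by0 M s + s * by1 M s)) s := by
    intro z
    refine ((hasDerivAt_pow m z).mul (by0_deriv M hM z)).congr_deriv ?_
    have e : z ^ m = z ^ (m-1) * z := by rw [← pow_succ]; congr 1; omega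
    rw [e]; ring
  have hRpos : ∀ x ∈ Icc s₁ s₂, 0 < R (x / q) := by
    intro x hx
    have := hpos x hx
    have : 0 < x := lt_of_lt_of_le h1 hx.1
    simp only [hR]; positivity
  have key := exists_hasDerivAt_eq_zero (f := fun s => R s * Real.exp (-(1/σ) * Real.log (R (s/q))))
    (f' := fun s => (s ^ (m-1) * (m * by0 M s + s * by1 M s))
        * Real.exp (-(1/σ) * Real.log (R (s/q)))
      + R s * (Real.exp (-(1/σ) * Real.log (R (s/q))) * (-(1/σ) * (((s/q) ^ (m-1) *
        (m * by0 M (s/q) + (s/q) * by1 M (s/q)) * (1/q)) / R (s/q))))) h12 ?_ ?_ ?_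
  · obtain ⟨κ, hκ, hk⟩ := key
    refine ⟨κ, hκ, ?_⟩
    have hE := Real.exp_pos (-(1/σ) * Real.log (R (κ/q)))
    have hκ0 : 0 < κ := h1.trans hκ.1
    have hRp := hpos κ ⟨hκ.1.le, hκ.2.le⟩
    set E := Real.exp (-(1/σ) * Real.log (R (κ/q)))
    simp only [hR] at hk
    set X := by0 M (κ/q)
    set Y := by1 M (κ/q)
    have e : ∀ z : ℝ, z ^ m = z ^ (m-1) * z := by
      intro z; rw [← pow_succ]; congr 1; omega
    rw [e κ, e (κ/q)] at hk
    have hw : 0 < (κ/q)^(m-1) := by positivity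
    have hw2 : 0 < κ^(m-1) := by positivity
    set w := (κ/q)^(m-1)
    set w2 := κ^(m-1)
    field_simp at hk ⊢
    rw [mul_zero, mul_eq_zero] at hk
    rcases hk with hk | hk
    · exact absurd hk (by positivity)
    · linarith
  · have : ∀ x ∈ Icc s₁ s₂, R (x / q) ≠ 0 := fun x hx => (hRpos x hx).ne'
    have hc : ContinuousOn (fun x => Real.log (R (x/q))) (Icc s₁ s₂) :=
      ContinuousOn.log (by fun_prop) this
    fun_prop
  · simp [hR, hz1, hz2]
  · intro x hx
    have hx' := hRpos x ⟨hx.1.le, hx.2.le⟩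
    have d1 : HasDerivAt (fun s : ℝ => s / q) (1/q) x := (hasDerivAt_id x).div_const q
    have d2 : HasDerivAt (fun s => R (s/q)) ((x/q) ^ (m-1) *
        (m * by0 M (x/q) + (x/q) * by1 M (x/q)) * (1/q)) x :=
      HasDerivAt.comp x (h₂ := R) (h := fun s => s / q) (dR (x/q)) d1
    exact (dR x).mul (((d2.log hx'.ne').const_mul (-(1/σ))).exp)

/-! ### The separated solutions -/

/-- Coefficients of `x₀ + i x₁`. -/
def zc (N : ℕ) (i : Fin N) : ℂ := if i.val = 0 then 1 else if i.val = 1 then Complex.I else 0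

/-- The real-linear map `x ↦ x₀ + i x₁`. -/
def zlin (N : ℕ) : EuclideanSpace ℝ (Fin N) →L[ℝ] ℂ :=
  ∑ i, (EuclideanSpace.proj i : EuclideanSpace ℝ (Fin N) →L[ℝ] ℝ).smulRight (zc N i)

lemma zlin_apply (N : ℕ) (x : EuclideanSpace ℝ (Fin N)) :
    zlin N x = ∑ i, (x i : ℂ) * zc N i := by
  simp [zlin]

lemma zlin_single (N : ℕ) (i : Fin N) : zlin N (EuclideanSpace.single i 1) = zc N i := by
  rw [zlin_apply, Finset.sum_eq_single i]
  · simp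
  · intro j _ hj; simp [hj]
  · simp

lemma zc_sq (N : ℕ) (hN : N = 2 ∨ N = 3) : ∑ i, zc N i ^ 2 = 0 := by
  rcases hN with rfl | rfl
  · simp [Fin.sum_univ_two, zc]
  · simp [Fin.sum_univ_three, zc]

/-- Derivative of `z^m g(|x|²)`. -/
lemma sep_hasFDerivAt (N m : ℕ) (g g' : ℝ → ℝ) (hg : ∀ t, HasDerivAt g (g' t) t)
    (y : EuclideanSpace ℝ (Fin N)) :
    HasFDerivAt (fun x => zlin N x ^ m * (g (‖x‖ ^ 2) : ℂ))
      (((m : ℂ) * zlin N y ^ (m - 1) * (g (‖y‖ ^ 2) : ℂ)) • zlin N +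
        (zlin N y ^ m * (g' (‖y‖ ^ 2) : ℂ) * 2) • (Complex.ofRealCLM.comp (innerSL ℝ y))) y := by
  have h1 : HasFDerivAt (fun x => zlin N x ^ m) (((m : ℂ) * zlin N y ^ (m - 1)) • zlin N) y := by
    have := (zlin N).hasFDerivAt (x := y)
    refine (this.pow m).congr_fderiv ?_
    ext v; simp
  have h2 : HasFDerivAt (fun x : EuclideanSpace ℝ (Fin N) => ‖x‖ ^ 2) (2 • innerSL ℝ y) y :=
    (hasStrictFDerivAt_norm_sq y).hasFDerivAt
  have h3 : HasFDerivAt (fun x : EuclideanSpace ℝ (Fin N) => g (‖x‖ ^ 2))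
      (g' (‖y‖^2) • (2 • innerSL ℝ y)) y := (hg (‖y‖^2)).comp_hasFDerivAt y h2
  have h4 : HasFDerivAt (fun x : EuclideanSpace ℝ (Fin N) => (g (‖x‖ ^ 2) : ℂ))
      (Complex.ofRealCLM.comp (g' (‖y‖^2) • (2 • innerSL ℝ y))) y :=
    (Complex.ofRealCLM.hasFDerivAt (x := g (‖y‖^2))).comp y h3
  refine (h1.mul h4).congr_fderiv ?_
  ext v
  simp
  ring

lemma sep_fderiv_single (N m : ℕ) (g g' : ℝ → ℝ) (hg : ∀ t, HasDerivAt g (g' t) t)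
    (y : EuclideanSpace ℝ (Fin N)) (i : Fin N) :
    fderiv ℝ (fun x => zlin N x ^ m * (g (‖x‖ ^ 2) : ℂ)) y (EuclideanSpace.single i 1) =
      (m * zc N i) * (zlin N y ^ (m - 1) * (g (‖y‖ ^ 2) : ℂ)) +
        (y i : ℂ) * (2 * (zlin N y ^ m * (g' (‖y‖ ^ 2) : ℂ))) := by
  rw [(sep_hasFDerivAt N m g g' hg y).fderiv]
  simp [zlin_single, EuclideanSpace.inner_single_right]
  ring

lemma sep_fderiv_self (N m : ℕ) (hm : 1 ≤ m) (g g' : ℝ → ℝ) (hg : ∀ t, HasDerivAt g (g' t) t)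
    (y : EuclideanSpace ℝ (Fin N)) :
    fderiv ℝ (fun x => zlin N x ^ m * (g (‖x‖ ^ 2) : ℂ)) y y =
      zlin N y ^ m * (m * g (‖y‖ ^ 2) + 2 * ‖y‖ ^ 2 * g' (‖y‖ ^ 2)) := by
  rw [(sep_hasFDerivAt N m g g' hg y).fderiv]
  have e : zlin N y ^ m = zlin N y ^ (m-1) * zlin N y := by rw [← pow_succ]; congr 1; omega
  simp
  rw [e]
  ring

lemma sep_lap (N m : ℕ) (hN : N = 2 ∨ N = 3) (hm : 1 ≤ m) (g g' g'' : ℝ → ℝ)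
    (hg : ∀ t, HasDerivAt g (g' t) t) (hg' : ∀ t, HasDerivAt g' (g'' t) t)
    (x : EuclideanSpace ℝ (Fin N)) :
    lap N (fun x => zlin N x ^ m * (g (‖x‖ ^ 2) : ℂ)) x =
      zlin N x ^ m * (4 * ‖x‖ ^ 2 * g'' (‖x‖ ^ 2) + 2 * (2 * m + N) * g' (‖x‖ ^ 2)) := by
  unfold lap
  have step : ∀ i : Fin N,
      fderiv ℝ (fun y => fderiv ℝ (fun x => zlin N x ^ m * (g (‖x‖ ^ 2) : ℂ)) y
        (EuclideanSpace.single i 1)) x (EuclideanSpace.single i 1) =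
      zc N i ^ 2 * (m * ((m - 1 : ℕ) * zlin N x ^ (m - 1 - 1) * g (‖x‖^2)))
      + ((x i : ℂ) * zc N i) * (4 * m * zlin N x ^ (m-1) * g' (‖x‖^2))
      + 2 * zlin N x ^ m * g' (‖x‖^2)
      + (x i : ℂ) ^ 2 * (4 * zlin N x ^ m * g'' (‖x‖^2)) := by
    intro i
    simp_rw [sep_fderiv_single N m g g' hg]
    have a1 := (sep_hasFDerivAt N (m-1) g g' hg x).const_mul ((m:ℂ) * zc N i)
    have a2 := (sep_hasFDerivAt N m g' g'' hg' x).const_mul (2:ℂ)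
    have a3 : HasFDerivAt (fun y : EuclideanSpace ℝ (Fin N) => ((y i : ℝ) : ℂ))
        (Complex.ofRealCLM.comp (EuclideanSpace.proj i : EuclideanSpace ℝ (Fin N) →L[ℝ] ℝ)) x :=
      (Complex.ofRealCLM.comp
        (EuclideanSpace.proj i : EuclideanSpace ℝ (Fin N) →L[ℝ] ℝ)).hasFDerivAt
    have a4 := a1.add (a3.mul a2)
    have a5 := a4.fderiv
    simp only [Pi.add_def, Pi.mul_def] at a5
    rw [a5]
    simp [zlin_single, EuclideanSpace.inner_single_right]
    ring
  rw [Finset.sum_congr rfl (fun i _ => step i)]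
  simp only [Finset.sum_add_distrib, ← Finset.sum_mul]
  rw [zc_sq N hN, ← zlin_apply]
  have hn : ∑ i, (x i : ℂ) ^ 2 = (‖x‖ : ℂ) ^ 2 := by
    rw [← Complex.ofReal_pow, EuclideanSpace.real_norm_sq_eq]; push_cast; rfl
  have e : zlin N x ^ m = zlin N x ^ (m-1) * zlin N x := by rw [← pow_succ]; congr 1; omega
  rw [hn, e]
  simp
  ring

/-- The separated solution of the Helmholtz equation with wave number `κ`. -/
def sepu (N m : ℕ) (c κ : ℝ) (x : EuclideanSpace ℝ (Fin N)) : ℂ :=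
  zlin N x ^ m * ((c * bess (2 * m + N) (κ ^ 2 * ‖x‖ ^ 2) : ℝ) : ℂ)

lemma sepg_deriv (M : ℕ) (hM : 1 ≤ M) (c κ t : ℝ) :
    HasDerivAt (fun t => c * bess M (κ ^ 2 * t))
      ((- c * κ ^ 2 / (2 * M)) * bess (M + 2) (κ ^ 2 * t)) t := by
  have h1 : HasDerivAt (fun t : ℝ => κ ^ 2 * t) (κ ^ 2) t := by
    simpa using (hasDerivAt_id t).const_mul (κ^2)
  have h2 := ((bess_hasDerivAt M hM (κ^2 * t)).comp t h1).const_mul c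
  refine h2.congr_deriv ?_
  ring

lemma sepu_contDiff (N m : ℕ) (hm : 1 ≤ m) (c κ : ℝ) : ContDiff ℝ 2 (sepu N m c κ) := by
  have h1 : ContDiff ℝ 2 (bess (2 * m + N)) := by
    exact_mod_cast bess_contDiff 2 (2*m+N) (by omega)
  have h2 : ContDiff ℝ 2 (fun x : EuclideanSpace ℝ (Fin N) => κ ^ 2 * ‖x‖ ^ 2) :=
    contDiff_const.mul (contDiff_norm_sq ℝ)
  have h3 := contDiff_const (c := c) |>.mul (h1.comp h2)
  exact ((zlin N).contDiff.pow m).mul (Complex.ofRealCLM.contDiff.comp h3)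

lemma sepu_lap (N m : ℕ) (hN : N = 2 ∨ N = 3) (hm : 1 ≤ m) (c κ : ℝ)
    (x : EuclideanSpace ℝ (Fin N)) :
    lap N (sepu N m c κ) x + (κ : ℂ) ^ 2 * sepu N m c κ x = 0 := by
  set M := 2 * m + N with hM
  have hM1 : 1 ≤ M := by omega
  have h := sep_lap N m hN hm _ _ _ (sepg_deriv M hM1 c κ)
    (sepg_deriv (M+2) (by omega) (- c * κ ^ 2 / (2 * M)) κ) x
  have e : (fun x => zlin N x ^ m * ((c * bess M (κ ^ 2 * ‖x‖ ^ 2) : ℝ) : ℂ)) = sepu N m c κ := by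
    ext x; rfl
  rw [e] at h
  rw [h]
  unfold sepu
  rw [← hM]
  have hc := bess_contig M hM1 (κ ^ 2 * ‖x‖ ^ 2)
  have hMr : (0:ℝ) < M := by exact_mod_cast hM1
  have hMM : (2 * m + N : ℂ) = ((M : ℝ) : ℂ) := by rw [hM]; push_cast; ring
  rw [hMM]
  set t := κ ^ 2 * ‖x‖ ^ 2 with ht
  have key : 4 * ‖x‖ ^ 2 * (- (- c * κ ^ 2 / (2 * M)) * κ ^ 2 / (2 * ((M + 2 : ℕ):ℝ)) * bess (M+2+2) t)
      + 2 * M * ((- c * κ ^ 2 / (2 * M)) * bess (M + 2) t) + κ ^ 2 * (c * bess M t) = 0 := by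
    have h4 : bess (M+2+2) t * t = M * (M+2) * (bess (M+2) t - bess M t) := by rw [← hc]; ring
    have : (M:ℝ) + 2 ≠ 0 := by positivity
    push_cast
    have h5 : 4 * ‖x‖ ^ 2 * (- (- c * κ ^ 2 / (2 * M)) * κ ^ 2 / (2 * ((M:ℝ) + 2)) * bess (M+2+2) t)
       = c * κ ^ 2 / (M * (M + 2)) * (bess (M+2+2) t * t) := by
      rw [ht]; field_simp; ring
    rw [h5, h4]
    field_simp
    ring
  have key' := congrArg (fun r : ℝ => zlin N x ^ m * (r : ℂ)) key
  simp only [Complex.ofReal_zero, mul_zero] at key'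
  rw [← key']
  push_cast
  ring

lemma sepu_self (N m : ℕ) (hm : 1 ≤ m) (c κ : ℝ) (x : EuclideanSpace ℝ (Fin N)) (hx : ‖x‖ = 1) :
    fderivWithin ℝ (sepu N m c κ) (closedBall (0 : EuclideanSpace ℝ (Fin N)) 1) x x
      = zlin N x ^ m * ((c * (m * by0 (2*m+N) κ + κ * by1 (2*m+N) κ) : ℝ) : ℂ) := by
  set M := 2 * m + N with hM
  have hM1 : 1 ≤ M := by omega
  have hMr : (0:ℝ) < M := by exact_mod_cast hM1
  have hu : UniqueDiffWithinAt ℝ (closedBall (0 : EuclideanSpace ℝ (Fin N)) 1) x := by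
    apply uniqueDiffOn_convex (convex_closedBall _ _)
    · rw [interior_closedBall _ one_ne_zero]
      exact ⟨0, by simp⟩
    · simp [hx]
  rw [fderivWithin_eq_fderiv hu ((sepu_contDiff N m hm c κ).differentiable (by norm_num) x)]
  have h := sep_fderiv_self N m hm _ _ (sepg_deriv M hM1 c κ) x
  have e : (fun x => zlin N x ^ m * ((c * bess M (κ ^ 2 * ‖x‖ ^ 2) : ℝ) : ℂ)) = sepu N m c κ := by
    ext x; rfl
  rw [e] at h
  rw [h, hx]
  congr 1
  have : c * (m * by0 M κ + κ * by1 M κ) = m * (c * bess M (κ ^ 2 * 1 ^ 2)) +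
      2 * 1 ^ 2 * ((- c * κ ^ 2 / (2 * M)) * bess (M + 2) (κ ^ 2 * 1 ^ 2)) := by
    unfold by0 by1
    simp only [one_pow, mul_one]
    field_simp
  rw [this]
  push_cast
  ring

lemma sepu_bdry (N m : ℕ) (c κ : ℝ) (x : EuclideanSpace ℝ (Fin N)) (hx : ‖x‖ = 1) :
    sepu N m c κ x = zlin N x ^ m * ((c * by0 (2*m+N) κ : ℝ) : ℂ) := by
  unfold sepu by0
  rw [hx]; simp

lemma divSigma_const (N : ℕ) (σ : ℝ) (u : EuclideanSpace ℝ (Fin N) → ℂ) (hu : ContDiff ℝ 2 u)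
    (x : EuclideanSpace ℝ (Fin N)) :
    divSigmaGrad N (fun _ => σ) u x = σ * lap N u x := by
  unfold divSigmaGrad lap
  rw [Finset.mul_sum]
  apply Finset.sum_congr rfl
  intro i _
  have h1 : ContDiff ℝ 1 (fun y => fderiv ℝ u y (EuclideanSpace.single i 1)) :=
    (hu.fderiv_right (m := 1) (by norm_num)).clm_apply contDiff_const
  have h2 := (h1.differentiable (by norm_num)) x
  have h3 := (h2.hasFDerivAt.const_mul (σ:ℂ)).fderiv
  rw [h3]
  simp

/-- Mass comparison through dilation. -/
lemma sepu_local (N m α b : ℕ) (hα : 1 ≤ α) (hb : 1 ≤ b) (hM : α + b + 2 = 2 * m + N) (d : ℕ)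
    (hd : α + d = m) (c κ l τ : ℝ) (hκ : 0 ≤ κ) (hl : 1 ≤ l) (hτ : 0 < τ) (hlτ : l * τ ≤ 1)
    (hT : (l * (κ * τ)) ^ 2 ≤ α * b) :
    ballL2 N (sepu N m c κ) τ / ballL2 N (sepu N m c κ) 1 ≤ (l⁻¹) ^ d := by
  set u := sepu N m c κ with hu
  have hl0 : 0 < l := by linarith
  have ucont : Continuous u := (sepu_contDiff N m (by omega) c κ).continuous
  have hpt : ∀ x ∈ ball (0 : EuclideanSpace ℝ (Fin N)) τ, ‖u x‖ ≤ (l⁻¹) ^ d * ‖u (l • x)‖ := by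
    intro x hx
    have hxτ : ‖x‖ ≤ τ := (mem_ball_zero_iff.1 hx).le
    have hs : 0 ≤ κ * ‖x‖ := by positivity
    obtain ⟨g1, g2⟩ := by0_growth (2*m+N) α b hα hb hM l (κ * ‖x‖) hl hs (by
      refine le_trans ?_ hT
      gcongr)
    have e1 : u x = zlin N x ^ m * ((c * by0 (2*m+N) (κ * ‖x‖) : ℝ) : ℂ) := by
      rw [hu]; unfold sepu by0; rw [mul_pow]
    have e2 : u (l • x) = (l:ℂ) ^ m * zlin N x ^ m * ((c * by0 (2*m+N) (l * (κ * ‖x‖)) : ℝ) : ℂ) := by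
      rw [hu]; unfold sepu by0
      rw [map_smul, norm_smul, Real.norm_of_nonneg hl0.le]
      rw [Complex.real_smul, mul_pow]
      rw [show κ ^ 2 * (l * ‖x‖) ^ 2 = (l * (κ * ‖x‖)) ^ 2 by ring]
    rw [e1, e2, norm_mul, norm_mul, norm_mul, Complex.norm_real, Complex.norm_real, norm_pow,
      norm_pow, Complex.norm_real, norm_mul, norm_mul, Real.norm_of_nonneg hl0.le,
      Real.norm_of_nonneg g1.le]
    have g3 : by0 (2*m+N) (κ * ‖x‖) ≤ l ^ α * ‖by0 (2*m+N) (l * (κ * ‖x‖))‖ :=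
      g2.trans (by gcongr; exact Real.le_norm_self _)
    calc _ ≤ ‖zlin N x‖ ^ m * (‖c‖ * (l ^ α * ‖by0 (2*m+N) (l * (κ * ‖x‖))‖)) := by gcongr
      _ = _ := by
        rw [← hd, pow_add l, inv_pow]
        field_simp
  have i1 : ∫ x in ball (0 : EuclideanSpace ℝ (Fin N)) τ, ‖u x‖ ^ 2
      ≤ ((l⁻¹) ^ d) ^ 2 * ∫ x in ball (0 : EuclideanSpace ℝ (Fin N)) 1, ‖u x‖ ^ 2 := by
    have hint : ∀ (f : EuclideanSpace ℝ (Fin N) → ℝ) (r : ℝ), Continuous f →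
        IntegrableOn f (ball 0 r) := fun f r hf =>
      (hf.continuousOn.integrableOn_compact (isCompact_closedBall 0 r)).mono_set
        ball_subset_closedBall
    calc ∫ x in ball (0 : EuclideanSpace ℝ (Fin N)) τ, ‖u x‖ ^ 2
        ≤ ∫ x in ball (0 : EuclideanSpace ℝ (Fin N)) τ, ((l⁻¹) ^ d) ^ 2 * ‖u (l • x)‖ ^ 2 := by
          apply setIntegral_mono_on
          · exact hint _ _ (by fun_prop)
          · exact hint _ _ (by fun_prop)
          · exact measurableSet_ball
          · intro x hx
            rw [← mul_pow]
            exact pow_le_pow_left₀ (norm_nonneg _) (hpt x hx) 2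
      _ = ((l⁻¹) ^ d) ^ 2 * ∫ x in ball (0 : EuclideanSpace ℝ (Fin N)) τ, ‖u (l • x)‖ ^ 2 := by
          rw [integral_const_mul]
      _ ≤ _ := by
          gcongr
          rw [Measure.setIntegral_comp_smul_of_pos volume (fun x => ‖u x‖ ^ 2) _ hl0,
            _root_.smul_ball hl0.ne', smul_zero, Real.norm_of_nonneg hl0.le, smul_eq_mul]
          have k1 : ∫ x in ball (0 : EuclideanSpace ℝ (Fin N)) (l * τ), ‖u x‖ ^ 2
              ≤ ∫ x in ball (0 : EuclideanSpace ℝ (Fin N)) 1, ‖u x‖ ^ 2 := by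
            apply setIntegral_mono_set
            · exact hint _ _ (by fun_prop)
            · exact Eventually.of_forall fun x => by positivity
            · exact (ball_subset_ball hlτ).eventuallyLE
          have k2 : 0 ≤ ∫ x in ball (0 : EuclideanSpace ℝ (Fin N)) (l * τ), ‖u x‖ ^ 2 :=
            integral_nonneg fun x => by positivity
          refine le_trans ?_ k1
          apply mul_le_of_le_one_left k2
          exact inv_le_one_of_one_le₀ (one_le_pow₀ hl)
  apply div_le_of_le_mul₀ (Real.sqrt_nonneg _) (by positivity)
  unfold ballL2
  rw [← Real.sqrt_sq (show 0 ≤ (l⁻¹) ^ d by positivity), ← Real.sqrt_mul (by positivity)]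
  exact Real.sqrt_le_sqrt i1

/-! ### Existence of localized eigenpairs -/

lemma sepu_ne (N m : ℕ) (hN : N = 2 ∨ N = 3) (c κ : ℝ) (h : c * by0 (2*m+N) κ ≠ 0) :
    ¬ EqOn (sepu N m c κ) 0 (closedBall (0 : EuclideanSpace ℝ (Fin N)) 1) := by
  intro h0
  have hN0 : 0 < N := by omega
  set x : EuclideanSpace ℝ (Fin N) := EuclideanSpace.single ⟨0, hN0⟩ 1 with hx
  have hx1 : ‖x‖ = 1 := by simp [hx]
  have h1 := h0 (show x ∈ closedBall (0 : EuclideanSpace ℝ (Fin N)) 1 by simp [hx1])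
  rw [sepu_bdry N m c κ x hx1, hx, zlin_single] at h1
  simp only [zc, if_true, one_pow, one_mul, Pi.zero_apply, Complex.ofReal_eq_zero] at h1
  exact h h1

set_option maxHeartbeats 2000000 in
lemma exists_localized (N : ℕ) (hN : N = 2 ∨ N = 3) (σ n : ℝ) (hσ : 0 < σ) (hn : 0 < n)
    (hns : σ < n ^ 2) (τ : ℝ) (hτ : τ ∈ Ioo (0:ℝ) 1) :
    ∃ l q : ℝ, 1 < l ∧ 0 < q ∧ ∀ d : ℕ, ∃ (k : ℝ) (u v : EuclideanSpace ℝ (Fin N) → ℂ),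
      0 < k ∧ d / q ≤ k ∧
      IsTransmissionEigenpair N k (fun _ => σ) (fun _ => n) u v ∧
      ¬ EqOn u 0 (closedBall (0 : EuclideanSpace ℝ (Fin N)) 1) ∧
      ¬ EqOn v 0 (closedBall (0 : EuclideanSpace ℝ (Fin N)) 1) ∧
      ballL2 N u τ / ballL2 N u 1 ≤ (l⁻¹) ^ d ∧
      ballL2 N v τ / ballL2 N v 1 ≤ (l⁻¹) ^ d := by
  obtain ⟨hτ0, hτ1⟩ := hτ
  set q := Real.sqrt (n ^ 2 / σ) with hq
  have hq2 : q ^ 2 * σ = n ^ 2 := by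
    rw [hq, Real.sq_sqrt (by positivity)]; field_simp
  have hq1 : 1 < q := by
    rw [hq, Real.lt_sqrt (by norm_num), one_pow, lt_div_iff₀ hσ]; linarith
  have hq0 : 0 < q := by linarith
  obtain ⟨μ, hμτ, hμq, hμ1⟩ : ∃ μ, τ ≤ μ ∧ 1 / q ≤ μ ∧ μ < 1 :=
    ⟨max τ (1/q), le_max_left _ _, le_max_right _ _, max_lt hτ1 (by
      rw [div_lt_one hq0]; exact hq1)⟩
  have hμ0 : 0 < μ := by linarith
  set A := 1 + (1 - μ) / 4 with hA
  have hA1 : 1 < A := by rw [hA]; linarith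
  set θ := A ^ 2 * μ with hθ
  have hθ1 : θ < 1 := by
    have : 0 < 1 - μ := by linarith
    have hx : (1:ℝ) - θ = (1-μ) * (1 - μ/2 - (1-μ)*μ/16) := by rw [hθ, hA]; ring
    have : 0 < (1-μ) * (1 - μ/2 - (1-μ)*μ/16) := by
      apply mul_pos this; nlinarith
    linarith
  have hθ0 : 0 < θ := by positivity
  have hAμ : A * μ ≤ θ := by rw [hθ]; nlinarith [mul_pos (by linarith : 0 < A) hμ0]
  set A1 := (1 + A) / 2 with hA1d
  have hA11 : 1 < A1 := by rw [hA1d]; linarith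
  have hA1A : A1 < A := by rw [hA1d]; linarith
  set δ := Real.sqrt (1 - 1 / A1 ^ 2) with hδ
  have hin : 0 < 1 - 1 / A1 ^ 2 := by
    rw [sub_pos, div_lt_one (by positivity)]; nlinarith
  have hδ0 : 0 < δ := Real.sqrt_pos.2 hin
  have hδ2 : 1 - δ ^ 2 = 1 / A1 ^ 2 := by rw [hδ, Real.sq_sqrt hin.le]; ring
  set ell := Real.pi / δ with hell
  have hell0 : 0 < ell := div_pos Real.pi_pos hδ0
  refine ⟨A, q, hA1, hq0, fun d => ?_⟩
  obtain ⟨m, hm⟩ := exists_nat_ge ((A1 + 3 * ell) / (A - A1) + d / (1 - θ) + d + 1)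
  have hAA : 0 < A - A1 := by linarith
  have h1θ : 0 < 1 - θ := by linarith
  have p1 : 0 ≤ (A1 + 3 * ell) / (A - A1) := by positivity
  have p2 : 0 ≤ (d:ℝ) / (1 - θ) := by positivity
  have pd : (0:ℝ) ≤ d := Nat.cast_nonneg d
  have hm1 : A1 + 3 * ell ≤ m * (A - A1) := by rw [← div_le_iff₀ hAA]; linarith
  have hm2 : (d:ℝ) ≤ m * (1 - θ) := by rw [← div_le_iff₀ h1θ]; linarith
  have hmd : d + 1 ≤ m := by
    have : (d:ℝ) + 1 ≤ m := by linarith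
    exact_mod_cast this
  have hmpos : (0:ℝ) < m := by linarith
  set M := 2 * m + N with hM
  obtain ⟨α, hα⟩ : ∃ α, α + d = m := ⟨m - d, by omega⟩
  obtain ⟨b, hb⟩ : ∃ b, b + 2 = m + d + N := ⟨m + d + N - 2, by omega⟩
  have hαb : α + b + 2 = M := by omega
  have hα1 : 1 ≤ α := by omega
  have hb1 : 1 ≤ b := by omega
  have hprod : (θ * m) ^ 2 ≤ α * b := by
    have e1 : (α:ℝ) = m - d := by rw [← hα]; push_cast; ring
    have e2 : (m:ℝ) + d ≤ b := by
      have : m + d ≤ b := by omega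
      exact_mod_cast this
    have e3 : 0 ≤ (m:ℝ) - d := by linarith
    have e4 : θ * m ≤ m - d := by linarith
    calc (θ * m) ^ 2 ≤ (m - d) ^ 2 := pow_le_pow_left₀ (by positivity) e4 2
      _ ≤ (m - d) * (m + d) := by nlinarith
      _ ≤ _ := by rw [e1]; gcongr
  have hbound : ∀ x : ℝ, 0 ≤ x → x ≤ θ * m → x ^ 2 ≤ α * b := fun x hx hx' =>
    (pow_le_pow_left₀ hx hx' 2).trans hprod
  -- zeros
  have hMle : (M:ℝ) ≤ 2 * m + 3 := by
    have : M ≤ 2 * m + 3 := by omega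
    exact_mod_cast this
  have hMge : (2:ℝ) * m + 2 ≤ M := by
    have : 2 * m + 2 ≤ M := by omega
    exact_mod_cast this
  set a := A1 * (m + 1) with ha
  have ha0 : 0 < a := by positivity
  have hsturm : ∀ a', a ≤ a' → ∃ s ∈ Icc a' (a' + ell), by0 M s = 0 := by
    intro a' haa
    apply sturm_zero M (by omega) δ a' hδ0 (by linarith)
    rw [hδ2]
    have : a ^ 2 ≤ a' ^ 2 := pow_le_pow_left₀ ha0.le haa 2
    have g1 : ((M:ℝ) - 1) * (M - 3) ≤ (2 * m + 2) * (2 * m + 2) :=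
      mul_le_mul (by linarith) (by linarith) (by
        have : (1:ℝ) ≤ m := by linarith
        linarith) (by linarith)
    calc ((M:ℝ) - 1) * (M - 3) / 4 ≤ ((m:ℝ) + 1) ^ 2 := by linarith
      _ = 1 / A1 ^ 2 * a ^ 2 := by rw [ha]; field_simp
      _ ≤ _ := by gcongr
  obtain ⟨s₁, hs1, hz1⟩ := hsturm a le_rfl
  obtain ⟨s₂, hs2, hz2⟩ := hsturm (a + 2 * ell) (by linarith)
  have hs1' := hs1.1
  have hs12 : s₁ < s₂ := by linarith [hs1.2, hs2.1]
  have hs2le : s₂ ≤ A * m := by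
    have := hs2.2
    have : a + 3 * ell ≤ A * m := by rw [ha]; linarith
    linarith
  have hs10 : 0 < s₁ := by linarith
  have hkθ : ∀ x, 0 ≤ x → x ≤ s₂ → x / q ≤ θ * m := by
    intro x hx hxs
    calc x / q = x * (1 / q) := by ring
      _ ≤ (A * m) * μ := by gcongr; linarith
      _ = (A * μ) * m := by ring
      _ ≤ _ := by gcongr
  have hposk : ∀ x ∈ Icc s₁ s₂, 0 < by0 M (x / q) := by
    intro x hx
    have hx0 : 0 ≤ x := by linarith [hx.1]
    exact by0_pos M α b hα1 hb1 hαb (x/q) (by positivity)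
      (hbound _ (by positivity) (hkθ x hx0 hx.2))
  obtain ⟨κ, hκ, heq⟩ := rolle_eig M m (by omega) (by omega) σ q s₁ s₂ hσ hq0 hs10 hs12 hz1 hz2 hposk
  have hκ0 : 0 < κ := hs10.trans hκ.1
  have hyk := hposk κ ⟨hκ.1.le, hκ.2.le⟩
  set k := κ / q with hk
  have hk0 : 0 < k := by positivity
  have hκk : κ = k * q := by rw [hk]; field_simp
  have hκA : κ ≤ A * m := hκ.2.le.trans hs2le
  have hyκ : by0 M κ ≠ 0 := by
    intro h0
    rw [h0] at heq
    have h1 : by1 M κ = 0 := by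
      have : (σ * κ * by0 M k) * by1 M κ = 0 := by linarith
      rcases mul_eq_zero.1 this with h | h
      · exact absurd h (by positivity)
      · exact h
    rcases energy_pos M (by omega) κ hκ0 with h | h
    · exact h h0
    · exact h h1
  set c := by0 M k / by0 M κ with hc
  have hcκ : c * by0 M κ = by0 M k := by rw [hc]; field_simp
  have hflux : σ * (c * (m * by0 M κ + κ * by1 M κ)) = 1 * (m * by0 M k + k * by1 M k) := by
    rw [hc]; field_simp; linarith
  have hune := sepu_ne N m hN c κ (by rw [← hM, hcκ]; exact hyk.ne')
  have hvne := sepu_ne N m hN 1 k (by rw [← hM, one_mul]; exact hyk.ne')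
  have cu := sepu_contDiff N m (by omega) c κ
  have cv := sepu_contDiff N m (by omega) 1 k
  refine ⟨k, sepu N m c κ, sepu N m 1 k, hk0, ?_, ?_, hune, hvne, ?_, ?_⟩
  · rw [hk]
    gcongr
    have : (m:ℝ) ≤ a := by rw [ha]; nlinarith
    linarith [hκ.1]
  · refine ⟨cu.contDiffOn, (cu.of_le (by norm_num)).contDiffOn, cv.contDiffOn,
      (cv.of_le (by norm_num)).contDiffOn, ?_, ?_, ?_, ?_, fun h => hune h.1⟩
    · intro x _
      rw [divSigma_const N σ _ cu]
      have h := sepu_lap N m hN (by omega) c κ x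
      have hz : (κ:ℂ) ^ 2 * σ = (k:ℂ) ^ 2 * (n:ℂ) ^ 2 := by
        have : κ ^ 2 * σ = k ^ 2 * n ^ 2 := by rw [hκk, ← hq2]; ring
        exact_mod_cast this
      rw [← hz]
      linear_combination (σ:ℂ) * h
    · intro x _
      exact sepu_lap N m hN (by omega) 1 k x
    · intro x hx
      rw [sepu_bdry N m c κ x hx, sepu_bdry N m 1 k x hx, ← hM, hcκ, one_mul]
    · intro x hx
      rw [sepu_self N m (by omega) c κ x hx, sepu_self N m (by omega) 1 k x hx, ← hM, ← hflux]
      push_cast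
      ring
  · refine sepu_local N m α b hα1 hb1 hαb d hα c κ A τ hκ0.le hA1.le hτ0 ?_ (hbound _ ?_ ?_)
    · calc A * τ ≤ A * μ := by gcongr
        _ ≤ 1 := by linarith
    · positivity
    · calc A * (κ * τ) ≤ A * ((A * m) * μ) := by gcongr
        _ = θ * m := by rw [hθ]; ring
  · refine sepu_local N m α b hα1 hb1 hαb d hα 1 k A τ hk0.le hA1.le hτ0 ?_ (hbound _ ?_ ?_)
    · calc A * τ ≤ A * μ := by gcongr
        _ ≤ 1 := by linarith
    · positivity
    · have : k ≤ κ := by rw [hκk]; nlinarith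
      calc A * (k * τ) ≤ A * ((A * m) * μ) := by
            have : k ≤ A * m := by linarith
            gcongr
        _ = θ * m := by rw [hθ]; ring

/-- Boundary localization of both the `u`- and `v`-parts of transmission eigenfunctions
for constant media with `n² > σ` on the unit ball. -/
theorem boundary_localization_constant
    (N : ℕ) (hN : N = 2 ∨ N = 3) (σ n : ℝ) (hσ : 0 < σ) (hn : 0 < n)
    (hns : σ < n ^ 2) (τ : ℝ) (hτ : τ ∈ Ioo (0:ℝ) 1) :
    ∃ (k : ℕ → ℝ) (u v : ℕ → EuclideanSpace ℝ (Fin N) → ℂ),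
      (∀ m, 0 < k m) ∧
      Tendsto k atTop atTop ∧
      (∀ m, IsTransmissionEigenpair N (k m) (fun _ => σ) (fun _ => n) (u m) (v m)) ∧
      (∀ m, ¬ EqOn (u m) 0 (closedBall (0 : EuclideanSpace ℝ (Fin N)) 1)) ∧
      (∀ m, ¬ EqOn (v m) 0 (closedBall (0 : EuclideanSpace ℝ (Fin N)) 1)) ∧
      Tendsto (fun m => ballL2 N (u m) τ / ballL2 N (u m) 1) atTop (nhds 0) ∧
      Tendsto (fun m => ballL2 N (v m) τ / ballL2 N (v m) 1) atTop (nhds 0) := by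
  obtain ⟨l, q, hl, hq, h⟩ := exists_localized N hN σ n hσ hn hns τ hτ
  choose k u v hk hkd hpair hu hv hul hvl using h
  have hlim : Tendsto (fun d : ℕ => (l⁻¹) ^ d) atTop (nhds 0) :=
    tendsto_pow_atTop_nhds_zero_of_lt_one (by positivity) (inv_lt_one_of_one_lt₀ hl)
  refine ⟨k, u, v, hk, ?_, hpair, hu, hv, ?_, ?_⟩
  · exact tendsto_atTop_mono hkd (tendsto_natCast_atTop_atTop.atTop_div_const hq)
  · exact squeeze_zero (fun m => div_nonneg (Real.sqrt_nonneg _) (Real.sqrt_nonneg _)) hul hlim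
  · exact squeeze_zero (fun m => div_nonneg (Real.sqrt_nonneg _) (Real.sqrt_nonneg _)) hvl hlim

end
end
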